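/- arXiv:math/0008088 — 6 statements merged into one kernel-verified Lean document; each statement's English description precedes it below -/
import Mathlib

section
/- Let n ≥ 2 and 0 < θ1 < π/2. Let λ1 > 0 and let y1 be a first eigenfunction of the m = 0 radial problem on (0,θ1): y1 twice continuously differentiable and strictly positive on (0,θ1), bounded near 0 with (sin θ)^{n−1} y1'(θ) → 0 as θ → 0⁺, solving −y1'' − (n−1) cot θ · y1' = λ1 y1, with y1(θ) → 0 as θ → θ1⁻. Define p(θ) := −y1'(θ)/y1(θ). Then the function θ ↦ p(θ) cot θ is strictly increasing on (0,θ1). -/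
open Real Set Filter

theorem strictMonoOn_Ioo_of_hasDerivAt_pos {g g' : ℝ → ℝ} {a b : ℝ}
    (hg : ∀ x ∈ Ioo a b, HasDerivAt g (g' x) x) (hg' : ∀ x ∈ Ioo a b, 0 < g' x) :
    StrictMonoOn g (Ioo a b) := by
  refine strictMonoOn_of_deriv_pos (convex_Ioo a b)
    (fun x hx => (hg x hx).continuousAt.continuousWithinAt) fun x hx => ?_
  rw [interior_Ioo] at hx
  rw [(hg x hx).deriv]
  exact hg' x hx

theorem monotoneOn_Ioo_of_hasDerivAt_nonneg {g g' : ℝ → ℝ} {a b : ℝ}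
    (hg : ∀ x ∈ Ioo a b, HasDerivAt g (g' x) x) (hg' : ∀ x ∈ Ioo a b, 0 ≤ g' x) :
    MonotoneOn g (Ioo a b) := by
  refine monotoneOn_of_deriv_nonneg (convex_Ioo a b)
    (fun x hx => (hg x hx).continuousAt.continuousWithinAt) (fun x hx => ?_) fun x hx => ?_
  · rw [interior_Ioo] at hx
    exact (hg x hx).differentiableAt.differentiableWithinAt
  · rw [interior_Ioo] at hx
    rw [(hg x hx).deriv]
    exact hg' x hx

theorem MonotoneOn.le_of_tendsto_nhdsGT {g : ℝ → ℝ} {a b l : ℝ} (hg : MonotoneOn g (Ioo a b))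
    (hl : Tendsto g (nhdsWithin a (Ioi a)) (nhds l)) : ∀ x ∈ Ioo a b, l ≤ g x := by
  intro x hx
  refine le_of_tendsto hl ?_
  filter_upwards [Ioo_mem_nhdsGT hx.1] with z hz
  exact hg ⟨hz.1, hz.2.trans hx.2⟩ hx hz.2.le

theorem StrictMonoOn.lt_of_tendsto_nhdsGT {g : ℝ → ℝ} {a b l : ℝ}
    (hg : StrictMonoOn g (Ioo a b))
    (hl : Tendsto g (nhdsWithin a (Ioi a)) (nhds l)) : ∀ x ∈ Ioo a b, l < g x := by
  intro x hx
  obtain ⟨z, hz⟩ := exists_between hx.1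
  have hz' : z ∈ Ioo a b := ⟨hz.1, hz.2.trans hx.2⟩
  exact (hg.monotoneOn.le_of_tendsto_nhdsGT hl z hz').trans_lt (hg hz' hx hz.2)

section RadialEigenfunction

variable {N : ℕ} {b lam : ℝ} {y y' : ℝ → ℝ}

theorem hasDerivAt_sin_pow_mul_of_radial {x y'' : ℝ} (hN : 1 ≤ N) (hs : Real.sin x ≠ 0)
    (hy' : HasDerivAt y' y'' x)
    (hode : -y'' - N * Real.cot x * y' x = lam * y x) :
    HasDerivAt (fun θ => Real.sin θ ^ N * y' θ) (-lam * Real.sin x ^ N * y x) x := by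
  have h := ((Real.hasDerivAt_sin x).pow N).mul hy'
  refine h.congr_deriv ?_
  obtain ⟨k, rfl⟩ : ∃ k, N = k + 1 := ⟨N - 1, by omega⟩
  have h2 : y'' = -(lam * y x) - ((k + 1 : ℕ) : ℝ) * Real.cot x * y' x := by linarith
  rw [h2, Real.cot_eq_cos_div_sin]
  simp only [Nat.add_sub_cancel, Pi.pow_apply]
  field_simp
  ring

theorem deriv_mul_cos_add_sin_mul_neg_of_radial (hb : 0 < b) (hb' : b < π / 2)
    (hy : ∀ x ∈ Ioo 0 b, HasDerivAt y (y' x) x)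
    (hpos : ∀ x ∈ Ioo 0 b, 0 < y x)
    (hflux : ∀ x ∈ Ioo 0 b,
      HasDerivAt (fun θ => Real.sin θ ^ N * y' θ) (-lam * Real.sin x ^ N * y x) x)
    (hbdd : ∃ M, ∀ᶠ θ in nhdsWithin 0 (Ioi 0), |y θ| ≤ M)
    (hflux0 : Tendsto (fun θ => Real.sin θ ^ N * y' θ) (nhdsWithin 0 (Ioi 0)) (nhds 0))
    (hyb : Tendsto y (nhdsWithin b (Iio b)) (nhds 0)) :
    (N : ℝ) + 1 < lam ∧ ∀ x ∈ Ioo 0 b, y' x * Real.cos x + Real.sin x * y x < 0 := by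
  have hsin : ∀ x ∈ Ioo 0 b, 0 < Real.sin x := fun x hx =>
    Real.sin_pos_of_pos_of_lt_pi hx.1 (by linarith [hx.2, Real.pi_pos])
  have hcos : ∀ x ∈ Ioo 0 b, 0 < Real.cos x := fun x hx =>
    Real.cos_pos_of_mem_Ioo ⟨by linarith [hx.1, Real.pi_pos], by linarith [hx.2]⟩
  set W : ℝ → ℝ := fun θ => Real.sin θ ^ N * y' θ * Real.cos θ + Real.sin θ ^ (N + 1) * y θ
    with hW
  have hWd : ∀ x ∈ Ioo 0 b,
      HasDerivAt W ((N + 1 - lam) * (Real.sin x ^ N * y x * Real.cos x)) x := by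
    intro x hx
    refine (((hflux x hx).mul (Real.hasDerivAt_cos x)).add
      (((Real.hasDerivAt_sin x).pow (N + 1)).mul (hy x hx))).congr_deriv ?_
    simp only [Nat.add_sub_cancel, Pi.pow_apply]
    push_cast
    ring
  have hW0 : Tendsto W (nhdsWithin 0 (Ioi 0)) (nhds 0) := by
    have hc : Tendsto Real.cos (nhdsWithin 0 (Ioi 0)) (nhds 1) := by
      simpa using (Real.continuous_cos.tendsto 0).mono_left nhdsWithin_le_nhds
    have hs : Tendsto (fun θ => Real.sin θ ^ (N + 1)) (nhdsWithin 0 (Ioi 0)) (nhds 0) := by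
      simpa [Pi.pow_def] using
        ((Real.continuous_sin.pow (N + 1)).tendsto 0).mono_left nhdsWithin_le_nhds
    obtain ⟨M, hM⟩ := hbdd
    have h2 : Tendsto (fun θ => Real.sin θ ^ (N + 1) * y θ) (nhdsWithin 0 (Ioi 0)) (nhds 0) := by
      refine squeeze_zero_norm' (a := fun θ => |Real.sin θ ^ (N + 1)| * M) ?_ ?_
      · filter_upwards [hM] with θ hθ
        rw [Real.norm_eq_abs, abs_mul]
        gcongr
      · simpa using hs.abs.mul_const M
    simpa [hW] using (hflux0.mul hc).add h2
  have hfactor : ∀ x, W x = Real.sin x ^ N * (y' x * Real.cos x + Real.sin x * y x) := by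
    intro x
    simp only [hW]
    ring
  have hlam : (N : ℝ) + 1 < lam := by
    by_contra! hle
    have hWnn : ∀ x ∈ Ioo 0 b, 0 ≤ W x :=
      (monotoneOn_Ioo_of_hasDerivAt_nonneg hWd fun x hx => by
        have := hsin x hx
        have := hcos x hx
        have := hpos x hx
        exact mul_nonneg (by linarith) (by positivity)).le_of_tendsto_nhdsGT hW0
    have hmono : MonotoneOn (fun θ => y θ / Real.cos θ) (Ioo 0 b) := by
      refine monotoneOn_Ioo_of_hasDerivAt_nonneg
        (fun x hx => (hy x hx).div (Real.hasDerivAt_cos x) (hcos x hx).ne') fun x hx => ?_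
      have h := hWnn x hx
      rw [hfactor] at h
      have h := nonneg_of_mul_nonneg_right h (pow_pos (hsin x hx) N)
      exact div_nonneg (by linarith) (sq_nonneg _)
    have hlim : Tendsto (fun θ => y θ / Real.cos θ) (nhdsWithin b (Iio b)) (nhds 0) := by
      have hcb : Real.cos b ≠ 0 :=
        (Real.cos_pos_of_mem_Ioo ⟨by linarith [Real.pi_pos], hb'⟩).ne'
      simpa [Pi.div_def] using hyb.div
        ((Real.continuous_cos.tendsto b).mono_left nhdsWithin_le_nhds) hcb
    have hmid : b / 2 ∈ Ioo 0 b := ⟨by linarith, by linarith⟩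
    have hle0 : y (b / 2) / Real.cos (b / 2) ≤ 0 := by
      refine ge_of_tendsto hlim ?_
      filter_upwards [Ioo_mem_nhdsLT hmid.2] with z hz
      exact hmono hmid ⟨hmid.1.trans hz.1, hz.2⟩ hz.1.le
    exact absurd (div_pos (hpos _ hmid) (hcos _ hmid)) hle0.not_gt
  refine ⟨hlam, fun x hx => ?_⟩
  have hneg := (strictMonoOn_Ioo_of_hasDerivAt_pos (fun x hx => (hWd x hx).neg) fun x hx => by
    have h : 0 < Real.sin x ^ N * y x * Real.cos x :=
      mul_pos (mul_pos (pow_pos (hsin x hx) N) (hpos x hx)) (hcos x hx)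
    nlinarith).lt_of_tendsto_nhdsGT (by simpa [Pi.neg_def] using hW0.neg) x hx
  have hneg : W x < 0 := by simpa using hneg
  rw [hfactor] at hneg
  exact (pos_iff_neg_of_mul_neg hneg).1 (pow_pos (hsin x hx) N)

theorem neg_deriv_mul_cos_le_of_radial (hb' : b < π / 2) (hlam : 0 ≤ lam) {Y : ℝ}
    (hpos : ∀ x ∈ Ioo 0 b, 0 < y x) (hY : ∀ x ∈ Ioo 0 b, y x ≤ Y)
    (hflux : ∀ x ∈ Ioo 0 b,
      HasDerivAt (fun θ => Real.sin θ ^ N * y' θ) (-lam * Real.sin x ^ N * y x) x)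
    (hflux0 : Tendsto (fun θ => Real.sin θ ^ N * y' θ) (nhdsWithin 0 (Ioi 0)) (nhds 0)) :
    ∀ x ∈ Ioo 0 b, -(y' x) * Real.cos x ≤ lam * Y / (N + 1) * Real.sin x := by
  have hsin : ∀ x ∈ Ioo 0 b, 0 < Real.sin x := fun x hx =>
    Real.sin_pos_of_pos_of_lt_pi hx.1 (by linarith [hx.2, Real.pi_pos])
  have hcos : ∀ x ∈ Ioo 0 b, 0 < Real.cos x := fun x hx =>
    Real.cos_pos_of_mem_Ioo ⟨by linarith [hx.1, Real.pi_pos], by linarith [hx.2]⟩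
  intro x hx
  have hY0 : 0 < Y := (hpos x hx).trans_le (hY x hx)
  set G : ℝ → ℝ := fun θ =>
    Real.sin θ ^ N * y' θ + lam * Y / (N + 1) * (Real.sin θ ^ (N + 1) / Real.cos θ) with hG
  have hGd : ∀ x ∈ Ioo 0 b, HasDerivAt G (lam * Real.sin x ^ N * (Y - y x) +
      lam * Y / (N + 1) * (Real.sin x ^ (N + 2) / Real.cos x ^ 2)) x := by
    intro x hx
    refine ((hflux x hx).add ((((Real.hasDerivAt_sin x).pow (N + 1)).div
      (Real.hasDerivAt_cos x) (hcos x hx).ne').const_mul _)).congr_deriv ?_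
    have := (hcos x hx).ne'
    have : (N : ℝ) + 1 ≠ 0 := by positivity
    simp only [Nat.add_sub_cancel, Pi.pow_apply]
    push_cast
    field_simp
    ring
  have hG0 : Tendsto G (nhdsWithin 0 (Ioi 0)) (nhds 0) := by
    have h : Tendsto (fun θ => Real.sin θ ^ (N + 1) / Real.cos θ)
        (nhdsWithin 0 (Ioi 0)) (nhds 0) := by
      simpa [Pi.pow_def, Pi.div_def] using (((Real.continuous_sin.pow (N + 1)).tendsto 0).div
        (Real.continuous_cos.tendsto 0) (by simp)).mono_left nhdsWithin_le_nhds
    simpa [hG] using hflux0.add (h.const_mul (lam * Y / (N + 1)))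
  have hGx : 0 ≤ G x :=
    (monotoneOn_Ioo_of_hasDerivAt_nonneg hGd fun x hx => by
      have := hsin x hx
      have := hcos x hx
      have := sub_nonneg.2 (hY x hx)
      positivity).le_of_tendsto_nhdsGT hG0 x hx
  have hc := hcos x hx
  have heq : G x * Real.cos x =
      Real.sin x ^ N * (y' x * Real.cos x + lam * Y / (N + 1) * Real.sin x) := by
    simp only [hG]
    field_simp
    ring
  have h := mul_nonneg hGx hc.le
  rw [heq] at h
  have := nonneg_of_mul_nonneg_right h (pow_pos (hsin x hx) N)
  linarith

end RadialEigenfunction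

/-- For a first Dirichlet eigenfunction `y1` of a geodesic ball of radius
`0 < θ1 < π/2` in `S^n`, with `p = -y1'/y1`, the function `θ ↦ p(θ) cot θ` is
strictly increasing on `(0,θ1)`. -/
theorem log_derivative_mul_cot_strictMono (n : ℕ) (hn : 2 ≤ n)
    (θ1 : ℝ) (hθ1 : 0 < θ1) (hθ1' : θ1 < π / 2)
    (lam1 : ℝ) (hlam1 : 0 < lam1) (y1 : ℝ → ℝ)
    (hy1 : ContDiffOn ℝ 2 y1 (Ioo 0 θ1))
    (hy1pos : ∀ θ ∈ Ioo 0 θ1, 0 < y1 θ)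
    (hy1bdd : ∃ M, ∀ᶠ θ in nhdsWithin 0 (Ioi 0), |y1 θ| ≤ M)
    (hy1d0 : Tendsto (fun θ => Real.sin θ ^ (n - 1) * deriv y1 θ)
      (nhdsWithin 0 (Ioi 0)) (nhds 0))
    (hode : ∀ θ ∈ Ioo 0 θ1,
      -(deriv (deriv y1) θ) - ((n : ℝ) - 1) * Real.cot θ * deriv y1 θ = lam1 * y1 θ)
    (hy1θ1 : Tendsto y1 (nhdsWithin θ1 (Iio θ1)) (nhds 0))
    (p : ℝ → ℝ) (hp : ∀ θ, p θ = -(deriv y1 θ) / y1 θ) :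
    StrictMonoOn (fun θ => p θ * Real.cot θ) (Ioo 0 θ1) := by
  obtain ⟨N, rfl⟩ : ∃ N, n = N + 1 := ⟨n - 1, by omega⟩
  have hN : 1 ≤ N := by omega
  simp only [Nat.add_sub_cancel, Nat.cast_add, Nat.cast_one, add_sub_cancel_right] at hy1d0 hode
  have hsin : ∀ x ∈ Ioo 0 θ1, 0 < Real.sin x := fun x hx =>
    Real.sin_pos_of_pos_of_lt_pi hx.1 (by linarith [hx.2, Real.pi_pos])
  have hcos : ∀ x ∈ Ioo 0 θ1, 0 < Real.cos x := fun x hx =>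
    Real.cos_pos_of_mem_Ioo ⟨by linarith [hx.1, Real.pi_pos], by linarith [hx.2]⟩
  have hy : ∀ x ∈ Ioo 0 θ1, HasDerivAt y1 (deriv y1 x) x := fun x hx =>
    ((hy1.differentiableOn (by norm_num)).differentiableAt (isOpen_Ioo.mem_nhds hx)).hasDerivAt
  have hy' : ∀ x ∈ Ioo 0 θ1, HasDerivAt (deriv y1) (deriv (deriv y1) x) x := fun x hx =>
    (((hy1.deriv_of_isOpen (m := 1) isOpen_Ioo (by norm_num)).differentiableOn
      (by norm_num)).differentiableAt (isOpen_Ioo.mem_nhds hx)).hasDerivAt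
  have hflux : ∀ x ∈ Ioo 0 θ1, HasDerivAt (fun θ => Real.sin θ ^ N * deriv y1 θ)
      (-lam1 * Real.sin x ^ N * y1 x) x := fun x hx =>
    hasDerivAt_sin_pow_mul_of_radial hN (hsin x hx).ne' (hy' x hx) (hode x hx)
  obtain ⟨hlam, hneg⟩ := deriv_mul_cos_add_sin_mul_neg_of_radial hθ1 hθ1' hy hy1pos hflux hy1bdd
    hy1d0 hy1θ1
  set q : ℝ → ℝ := fun θ => p θ * Real.cot θ with hq
  have hq_eq : ∀ θ, q θ = -(deriv y1 θ) / y1 θ * (Real.cos θ / Real.sin θ) := fun θ => by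
    simp only [hq, hp, Real.cot_eq_cos_div_sin]
  have hq1 : ∀ x ∈ Ioo 0 θ1, 1 < q x := by
    intro x hx
    rw [hq_eq, div_mul_div_comm, one_lt_div (mul_pos (hy1pos x hx) (hsin x hx))]
    linarith [hneg x hx]
  set F : ℝ → ℝ := fun θ =>
    lam1 - (N + 1) * q θ + Real.tan θ ^ 2 * (q θ ^ 2 - q θ) with hF
  have htan : ∀ x ∈ Ioo 0 θ1, 0 < Real.tan x := fun x hx =>
    Real.tan_pos_of_pos_of_lt_pi_div_two hx.1 (hx.2.trans hθ1')
  have hqd : ∀ x ∈ Ioo 0 θ1, HasDerivAt q (F x / Real.tan x) x := by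
    intro x hx
    have hs := (hsin x hx).ne'
    have hc := (hcos x hx).ne'
    have hyx := (hy1pos x hx).ne'
    have h := (((hy' x hx).neg).div (hy x hx) hyx).mul
      ((Real.hasDerivAt_cos x).div (Real.hasDerivAt_sin x) hs)
    have h2 : deriv (deriv y1) x = -(lam1 * y1 x) - N * Real.cot x * deriv y1 x := by
      linarith [hode x hx]
    refine (h.congr_of_eventuallyEq (Eventually.of_forall fun θ => hq_eq θ)).congr_deriv ?_
    simp only [hF, hq_eq, h2, Real.cot_eq_cos_div_sin, Real.tan_eq_sin_div_cos, Pi.neg_apply,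
      Pi.div_apply]
    field_simp
    ring
  have hFd : ∀ x ∈ Ioo 0 θ1, HasDerivAt F
      ((-(N + 1) + Real.tan x ^ 2 * (2 * q x - 1)) * (F x / Real.tan x) +
        2 * Real.tan x * (1 / Real.cos x ^ 2) * (q x ^ 2 - q x)) x := by
    intro x hx
    have hd := hqd x hx
    have h := ((hd.const_mul ((N : ℝ) + 1)).const_sub lam1).add
      (((Real.hasDerivAt_tan (hcos x hx).ne').pow 2).mul ((hd.pow 2).sub hd))
    refine h.congr_deriv ?_
    simp only [Pi.pow_apply, Pi.sub_apply]
    push_cast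
    ring
  have hFpos : ∀ x ∈ Ioo 0 θ1, F x = 0 →
      0 < (-(N + 1) + Real.tan x ^ 2 * (2 * q x - 1)) * (F x / Real.tan x) +
        2 * Real.tan x * (1 / Real.cos x ^ 2) * (q x ^ 2 - q x) := by
    intro x hx h0
    have := htan x hx
    have := hcos x hx
    have : 0 < q x ^ 2 - q x := by nlinarith [hq1 x hx]
    rw [h0, zero_div, mul_zero, zero_add]
    positivity
  have hFback : ∀ x ∈ Ioo 0 θ1, ∀ z ∈ Ioo 0 θ1, x ≤ z → 0 ≤ F x → 0 ≤ F z := by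
    intro x hx z hz hxz hFx
    have hsub : ∀ w ∈ Icc x z, w ∈ Ioo 0 θ1 := fun w hw =>
      ⟨hx.1.trans_le hw.1, hw.2.trans_lt hz.2⟩
    have h := image_le_of_deriv_right_lt_deriv_boundary (f := fun w => -F w) (B := fun _ => 0)
      (B' := fun _ => 0)
      (fun w hw => (hFd w (hsub w hw)).neg.continuousAt.continuousWithinAt)
      (fun w hw => (hFd w (hsub w (Ico_subset_Icc_self hw))).neg.hasDerivWithinAt)
      (by simpa using hFx) (fun w => hasDerivAt_const w 0)
      (fun w hw hw0 => neg_neg_of_pos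
        (hFpos w (hsub w (Ico_subset_Icc_self hw)) (neg_eq_zero.1 hw0)))
      (right_mem_Icc.2 hxz)
    simpa using h
  have hanti : AntitoneOn y1 (Ioo 0 θ1) := by
    have h := monotoneOn_Ioo_of_hasDerivAt_nonneg (fun x hx => (hy x hx).neg) fun x hx => by
      have h1 := hneg x hx
      have h2 := mul_pos (hsin x hx) (hy1pos x hx)
      by_contra! h3
      nlinarith [hcos x hx]
    exact fun x hx z hz hxz => neg_le_neg_iff.1 (h hx hz hxz)
  have hbdd : BddAbove (y1 '' Ioo 0 θ1) := by
    obtain ⟨M, hM⟩ := hy1bdd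
    refine ⟨M, ?_⟩
    rintro _ ⟨x, hx, rfl⟩
    obtain ⟨z, hzM, hz⟩ := (hM.and (Ioo_mem_nhdsGT hx.1)).exists
    exact (hanti ⟨hz.1, hz.2.trans hx.2⟩ hx hz.2.le).trans ((le_abs_self _).trans hzM)
  have hupper := neg_deriv_mul_cos_le_of_radial hθ1' hlam1.le hy1pos
    (fun x hx => le_csSup hbdd (mem_image_of_mem y1 hx)) hflux hy1d0
  set Y := sSup (y1 '' Ioo 0 θ1) with hYdef
  have hFnonneg : ∀ x ∈ Ioo 0 θ1, 0 ≤ F x := by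
    intro c hc
    by_contra! hFc
    have hq_ge : ∀ x ∈ Ioo 0 c, q c ≤ q x := by
      intro x hx
      have hsub : ∀ w ∈ Icc x c, w ∈ Ioo 0 θ1 := fun w hw =>
        ⟨hx.1.trans_le hw.1, hw.2.trans_lt hc.2⟩
      have hanti_q : AntitoneOn q (Icc x c) := by
        refine antitoneOn_of_deriv_nonpos (convex_Icc x c)
          (fun w hw => (hqd w (hsub w hw)).continuousAt.continuousWithinAt)
          (fun w hw => (hqd w (hsub w (interior_subset hw))).differentiableAt.differentiableWithinAt)
          fun w hw => ?_
        have hw := interior_subset hw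
        rw [(hqd w (hsub w hw)).deriv]
        have hFw : F w < 0 := by
          by_contra! h
          exact hFc.not_ge (hFback w (hsub w hw) c hc hw.2 h)
        exact (div_neg_of_neg_of_pos hFw (htan w (hsub w hw))).le
      exact hanti_q (left_mem_Icc.2 hx.2.le) (right_mem_Icc.2 hx.2.le) hx.2.le
    have hqc := hq1 c hc
    have hN1 : (0 : ℝ) < N + 1 := by positivity
    have hsmall : ∀ x ∈ Ioo 0 c, q c * y1 x ≤ lam1 * Y / (N + 1) := by
      intro x hx
      have hx' : x ∈ Ioo 0 θ1 := ⟨hx.1, hx.2.trans hc.2⟩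
      have hyx := hy1pos x hx'
      have hsx := hsin x hx'
      have h1 : q x * y1 x * Real.sin x = -(deriv y1 x) * Real.cos x := by
        rw [hq_eq]
        field_simp
      have h2 : q x * y1 x ≤ lam1 * Y / (N + 1) :=
        le_of_mul_le_mul_right (h1.trans_le (hupper x hx')) hsx
      exact (mul_le_mul_of_nonneg_right (hq_ge x hx) hyx.le).trans h2
    have hYle : Y ≤ lam1 * Y / (N + 1) / q c := by
      refine csSup_le ((nonempty_Ioo.2 hθ1).image y1) ?_
      rintro _ ⟨x, hx, rfl⟩
      obtain ⟨z, hz⟩ := exists_between (lt_min hx.1 hc.1)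
      have hzx : z < x := hz.2.trans_le (min_le_left _ _)
      have hzc : z < c := hz.2.trans_le (min_le_right _ _)
      rw [le_div_iff₀ (by linarith)]
      have h1 := hsmall z ⟨hz.1, hzc⟩
      have h2 := hanti ⟨hz.1, hzx.trans hx.2⟩ hx hzx.le
      nlinarith
    have hYpos : 0 < Y := (hy1pos c hc).trans_le (le_csSup hbdd (mem_image_of_mem y1 hc))
    rw [div_div, le_div_iff₀ (by positivity)] at hYle
    have hle : (N + 1) * q c ≤ lam1 := by
      refine le_of_mul_le_mul_left ?_ hYpos
      linarith
    have : 0 < Real.tan c ^ 2 * (q c ^ 2 - q c) :=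
      mul_pos (pow_pos (htan c hc) 2) (by nlinarith)
    simp only [hF] at hFc
    linarith
  refine strictMonoOn_Ioo_of_hasDerivAt_pos hqd fun x hx => div_pos ?_ (htan x hx)
  refine (hFnonneg x hx).lt_of_ne fun h0 => ?_
  have hmin : IsLocalMin F x := by
    filter_upwards [isOpen_Ioo.mem_nhds hx] with z hz
    rw [← h0]
    exact hFnonneg z hz
  exact (hFpos x hx h0.symm).ne' (hmin.hasDerivAt_eq_zero (hFd x hx))
end

section
/- The function ℓ(θ) := cot θ − θ/sin²θ is negative, strictly decreasing, and strictly concave on the interval (0,π). -/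
open Real Set

theorem mul_cos_lt_sin {θ : ℝ} (hθ : θ ∈ Ioo 0 π) : θ * cos θ < sin θ := by
  have hmono : StrictMonoOn (fun x => sin x - x * cos x) (Icc 0 π) := by
    apply strictMonoOn_of_deriv_pos (convex_Icc _ _) (by fun_prop)
    intro x hx
    rw [interior_Icc] at hx
    have hd : HasDerivAt (fun x => sin x - x * cos x) (x * sin x) x := by
      refine HasDerivAt.congr_deriv
        ((hasDerivAt_sin x).sub ((hasDerivAt_id x).mul (hasDerivAt_cos x))) ?_
      simp only [id]
      ring
    rw [hd.deriv]
    exact mul_pos hx.1 (sin_pos_of_mem_Ioo hx)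
  simpa using hmono ⟨le_rfl, pi_pos.le⟩ (Ioo_subset_Icc_self hθ) hθ.1

theorem three_mul_sin_mul_cos_lt {θ : ℝ} (hθ : θ ∈ Ioo 0 π) :
    3 * (sin θ * cos θ) < θ * (1 + 2 * cos θ ^ 2) := by
  have hmono : StrictMonoOn (fun x => x * (1 + 2 * cos x ^ 2) - 3 * (sin x * cos x))
      (Icc 0 π) := by
    apply strictMonoOn_of_deriv_pos (convex_Icc _ _) (by fun_prop)
    intro x hx
    rw [interior_Icc] at hx
    have hd : HasDerivAt (fun x => x * (1 + 2 * cos x ^ 2) - 3 * (sin x * cos x))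
        (4 * (sin x * (sin x - x * cos x))) x := by
      refine HasDerivAt.congr_deriv
        (((hasDerivAt_id x).mul ((((hasDerivAt_cos x).pow 2).const_mul 2).const_add 1)).sub
        (((hasDerivAt_sin x).mul (hasDerivAt_cos x)).const_mul 3)) ?_
      simp only [id, Pi.pow_apply]
      push_cast
      linear_combination -sin_sq_add_cos_sq x
    rw [hd.deriv]
    have := mul_pos (sin_pos_of_mem_Ioo hx) (sub_pos.2 (mul_cos_lt_sin hx))
    positivity
  simpa using hmono ⟨le_rfl, pi_pos.le⟩ (Ioo_subset_Icc_self hθ) hθ.1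

theorem hasDerivAt_cot_sub_div_sin_sq {θ : ℝ} (hθ : sin θ ≠ 0) :
    HasDerivAt (fun θ => Real.cot θ - θ / sin θ ^ 2)
      (2 * (θ * cos θ - sin θ) / sin θ ^ 3) θ := by
  simp only [Real.cot_eq_cos_div_sin]
  refine HasDerivAt.congr_deriv
    (((hasDerivAt_cos θ).div (hasDerivAt_sin θ) hθ).sub
    ((hasDerivAt_id θ).div ((hasDerivAt_sin θ).pow 2) (pow_ne_zero 2 hθ))) ?_
  simp only [id]
  field_simp
  push_cast
  linear_combination -sin θ ^ 2 * sin_sq_add_cos_sq θ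

theorem hasDerivAt_mul_cos_sub_sin_div_sin_cube {θ : ℝ} (hθ : sin θ ≠ 0) :
    HasDerivAt (fun θ => 2 * (θ * cos θ - sin θ) / sin θ ^ 3)
      (2 * (3 * (sin θ * cos θ) - θ * (1 + 2 * cos θ ^ 2)) / sin θ ^ 4) θ := by
  refine HasDerivAt.congr_deriv
    (((((hasDerivAt_id θ).mul (hasDerivAt_cos θ)).sub (hasDerivAt_sin θ)).const_mul 2).div
    ((hasDerivAt_sin θ).pow 3) (pow_ne_zero 3 hθ)) ?_
  simp only [id, Pi.mul_apply, Pi.sub_apply]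
  field_simp
  push_cast
  linear_combination -θ * sin θ ^ 2 * sin_sq_add_cos_sq θ

/-- The function `ℓ(θ) = cot θ - θ/sin²θ` is negative, strictly decreasing, and
strictly concave on `(0,π)`. -/
theorem ell_neg_strictAnti_strictConcave :
    (∀ θ ∈ Ioo 0 π, Real.cot θ - θ / Real.sin θ ^ 2 < 0) ∧
    StrictAntiOn (fun θ => Real.cot θ - θ / Real.sin θ ^ 2) (Ioo 0 π) ∧
    StrictConcaveOn ℝ (Ioo 0 π) (fun θ => Real.cot θ - θ / Real.sin θ ^ 2) := by
  have hsin : ∀ θ ∈ Ioo 0 π, 0 < sin θ := fun _ => sin_pos_of_mem_Ioo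
  have hd : ∀ θ ∈ Ioo 0 π, HasDerivAt (fun θ => Real.cot θ - θ / sin θ ^ 2)
      (2 * (θ * cos θ - sin θ) / sin θ ^ 3) θ :=
    fun θ hθ => hasDerivAt_cot_sub_div_sin_sq (hsin θ hθ).ne'
  have hcont : ContinuousOn (fun θ => Real.cot θ - θ / sin θ ^ 2) (Ioo 0 π) :=
    fun θ hθ => (hd θ hθ).continuousAt.continuousWithinAt
  refine ⟨fun θ hθ => ?_, ?_, ?_⟩
  · have hs := hsin θ hθ
    have hlt : sin θ * cos θ < θ := by
      have := sin_lt (mul_pos two_pos hθ.1)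
      rw [sin_two_mul] at this
      linarith
    have heq : Real.cot θ - θ / sin θ ^ 2 = (sin θ * cos θ - θ) / sin θ ^ 2 := by
      rw [Real.cot_eq_cos_div_sin]
      field_simp
    rw [heq]
    exact div_neg_of_neg_of_pos (sub_neg.2 hlt) (by positivity)
  · apply strictAntiOn_of_deriv_neg (convex_Ioo _ _) hcont
    intro θ hθ
    rw [interior_Ioo] at hθ
    rw [(hd θ hθ).deriv]
    exact div_neg_of_neg_of_pos (by linarith [mul_cos_lt_sin hθ]) (pow_pos (hsin θ hθ) 3)
  · apply strictConcaveOn_of_deriv2_neg' (convex_Ioo _ _) hcont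
    intro θ hθ
    have heq : deriv (fun θ => Real.cot θ - θ / sin θ ^ 2) =ᶠ[nhds θ]
        fun θ => 2 * (θ * cos θ - sin θ) / sin θ ^ 3 := by
      filter_upwards [isOpen_Ioo.mem_nhds hθ] with x hx using (hd x hx).deriv
    rw [Function.iterate_succ, Function.iterate_one, Function.comp_apply, heq.deriv_eq,
      (hasDerivAt_mul_cos_sub_sin_div_sin_cube (hsin θ hθ).ne').deriv]
    exact div_neg_of_neg_of_pos (by linarith [three_mul_sin_mul_cos_lt hθ])
      (pow_pos (hsin θ hθ) 4)
end

section
/- The function m(θ) := (1 − θ cot θ)/sin²θ is positive, strictly increasing, and convex on the interval (0,π); moreover m(θ) → 1/3 as θ → 0⁺, m(π/2) = 1, and m(θ) → +∞ as θ → π⁻. -/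
open Real Set Filter

/-- A function vanishing at `0` with positive derivative on `(0, b)` is positive there. -/
lemma pos_of_hasDerivAt_pos {f f' : ℝ → ℝ} {b : ℝ} (h0 : f 0 = 0)
    (hf : ∀ x, HasDerivAt f (f' x) x) (hpos : ∀ x ∈ Ioo 0 b, 0 < f' x) :
    ∀ x ∈ Ioo 0 b, 0 < f x := by
  intro x hx
  have hmono : StrictMonoOn f (Ico 0 b) := by
    refine strictMonoOn_of_deriv_pos (convex_Ico 0 b)
      (fun y _ => (hf y).continuousAt.continuousWithinAt) fun y hy => ?_
    rw [interior_Ico] at hy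
    rw [(hf y).deriv]
    exact hpos y hy
  have h := hmono ⟨le_rfl, hx.1.trans hx.2⟩ ⟨hx.1.le, hx.2⟩ hx.1
  rwa [h0] at h

lemma hasDerivAt_sin_sub_mul_cos (x : ℝ) :
    HasDerivAt (fun x => sin x - x * cos x) (x * sin x) x := by
  refine ((hasDerivAt_sin x).sub ((hasDerivAt_id' x).mul (hasDerivAt_cos x))).congr_deriv ?_
  ring

lemma sin_sub_mul_cos_pos : ∀ x ∈ Ioo 0 π, 0 < sin x - x * cos x :=
  pos_of_hasDerivAt_pos (by simp) hasDerivAt_sin_sub_mul_cos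
    fun _ hx => mul_pos hx.1 (sin_pos_of_mem_Ioo hx)

lemma hasDerivAt_mul_add_cos_sq_sub (a b x : ℝ) :
    HasDerivAt (fun x => x * (a + b * cos x ^ 2) - (a + b) * (sin x * cos x))
      (sin x * ((2 * a + b) * sin x - 2 * b * (x * cos x))) x := by
  have hs := hasDerivAt_sin x
  have hc := hasDerivAt_cos x
  refine (((hasDerivAt_id' x).mul (((hc.pow 2).const_mul b).const_add a)).sub
    ((hs.mul hc).const_mul (a + b))).congr_deriv ?_
  have := sin_sq_add_cos_sq x
  simp
  linear_combination (-a) * this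

lemma mul_add_cos_sq_sub_pos {a b : ℝ} (hb : 0 < b) (hab : b ≤ 2 * a) :
    ∀ x ∈ Ioo 0 π, 0 < x * (a + b * cos x ^ 2) - (a + b) * (sin x * cos x) := by
  refine pos_of_hasDerivAt_pos (by simp) (hasDerivAt_mul_add_cos_sq_sub a b) fun x hx => ?_
  have hs := sin_pos_of_mem_Ioo hx
  have hA := sin_sub_mul_cos_pos x hx
  refine mul_pos hs ?_
  nlinarith [mul_pos hb hA, mul_nonneg (sub_nonneg.2 hab) hs.le]

lemma sin_mul_sub_mul_cos_pos :
    ∀ x ∈ Ioo 0 π, 0 < sin x * (1 + 2 * cos x ^ 2) - x * (cos x * (2 + cos x ^ 2)) := by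
  refine pos_of_hasDerivAt_pos
    (f' := fun x => sin x * (x * (2 + 3 * cos x ^ 2) - (2 + 3) * (sin x * cos x)))
    (by simp) (fun x => ?_) fun x hx => mul_pos (sin_pos_of_mem_Ioo hx)
      (mul_add_cos_sq_sub_pos (by norm_num) (by norm_num) x hx)
  have hs := hasDerivAt_sin x
  have hc := hasDerivAt_cos x
  refine ((hs.mul (((hc.pow 2).const_mul 2).const_add 1)).sub
    ((hasDerivAt_id' x).mul (hc.mul ((hc.pow 2).const_add 2)))).congr_deriv ?_
  have := sin_sq_add_cos_sq x
  simp
  linear_combination cos x * this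

lemma one_sub_mul_cot_div_sin_sq {x : ℝ} (hx : sin x ≠ 0) :
    (1 - x * Real.cot x) / sin x ^ 2 = (sin x - x * cos x) / sin x ^ 3 := by
  rw [Real.cot_eq_cos_div_sin]
  field_simp

lemma hasDerivAt_sin_sub_mul_cos_div {x : ℝ} (hx : sin x ≠ 0) :
    HasDerivAt (fun x => (sin x - x * cos x) / sin x ^ 3)
      ((x * (1 + 2 * cos x ^ 2) - (1 + 2) * (sin x * cos x)) / sin x ^ 4) x := by
  refine ((hasDerivAt_sin_sub_mul_cos x).div ((hasDerivAt_sin x).pow 3)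
    (pow_ne_zero 3 hx)).congr_deriv ?_
  have := sin_sq_add_cos_sq x
  simp
  field_simp
  linear_combination x * this

lemma hasDerivAt_mul_sub_sin_mul_cos_div {x : ℝ} (hx : sin x ≠ 0) :
    HasDerivAt (fun x => (x * (1 + 2 * cos x ^ 2) - (1 + 2) * (sin x * cos x)) / sin x ^ 4)
      (4 * (sin x * (1 + 2 * cos x ^ 2) - x * (cos x * (2 + cos x ^ 2))) / sin x ^ 5) x := by
  refine ((hasDerivAt_mul_add_cos_sq_sub 1 2 x).div ((hasDerivAt_sin x).pow 4)
    (pow_ne_zero 4 hx)).congr_deriv ?_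
  have := sin_sq_add_cos_sq x
  simp
  field_simp
  linear_combination (4 * sin x - 4 * x * cos x) * this

lemma strictMonoOn_sin_sub_mul_cos_div :
    StrictMonoOn (fun x => (sin x - x * cos x) / sin x ^ 3) (Ioo 0 π) := by
  have hd : ∀ x ∈ Ioo 0 π, _ := fun x hx =>
    hasDerivAt_sin_sub_mul_cos_div (sin_pos_of_mem_Ioo hx).ne'
  refine strictMonoOn_of_deriv_pos (convex_Ioo 0 π)
    (fun x hx => (hd x hx).continuousAt.continuousWithinAt) fun x hx => ?_
  rw [interior_Ioo] at hx
  rw [(hd x hx).deriv]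
  exact div_pos (mul_add_cos_sq_sub_pos two_pos (by norm_num) x hx)
    (pow_pos (sin_pos_of_mem_Ioo hx) 4)

lemma convexOn_sin_sub_mul_cos_div :
    ConvexOn ℝ (Ioo 0 π) (fun x => (sin x - x * cos x) / sin x ^ 3) := by
  have hs : ∀ x ∈ Ioo 0 π, sin x ≠ 0 := fun x hx => (sin_pos_of_mem_Ioo hx).ne'
  refine convexOn_of_hasDerivWithinAt2_nonneg (convex_Ioo 0 π)
    (fun x hx => (hasDerivAt_sin_sub_mul_cos_div
      (hs x hx)).continuousAt.continuousWithinAt)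
    (fun x hx => (hasDerivAt_sin_sub_mul_cos_div
      (hs x (interior_subset hx))).hasDerivWithinAt)
    (fun x hx => (hasDerivAt_mul_sub_sin_mul_cos_div
      (hs x (interior_subset hx))).hasDerivWithinAt) fun x hx => ?_
  rw [interior_Ioo] at hx
  exact (div_pos (mul_pos four_pos (sin_mul_sub_mul_cos_pos x hx))
    (pow_pos (sin_pos_of_mem_Ioo hx) 5)).le

lemma tendsto_sin_sub_mul_cos_div_zero :
    Tendsto (fun x => (sin x - x * cos x) / sin x ^ 3) (nhdsWithin 0 (Ioi 0))
      (nhds (1 / 3)) := by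
  have hmem : Ioo 0 (π / 2) ∈ nhdsWithin (0 : ℝ) (Ioi 0) :=
    Ioo_mem_nhdsGT (by positivity)
  have hs : ∀ x ∈ Ioo 0 (π / 2), 0 < sin x := fun x hx =>
    sin_pos_of_pos_of_lt_pi hx.1 (by linarith [hx.1, hx.2])
  have hc : ∀ x ∈ Ioo 0 (π / 2), 0 < cos x := fun x hx =>
    cos_pos_of_mem_Ioo ⟨by linarith [hx.1, hx.2], hx.2⟩
  refine HasDerivAt.lhopital_zero_nhdsGT (f' := fun x => x * sin x)
    (g' := fun x => 3 * sin x ^ 2 * cos x)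
    (Eventually.of_forall hasDerivAt_sin_sub_mul_cos)
    (Eventually.of_forall fun x => ((hasDerivAt_sin x).pow 3).congr_deriv (by simp)) ?_ ?_ ?_ ?_
  · filter_upwards [hmem] with x hx
    have := hs x hx
    have := hc x hx
    positivity
  · exact ((Continuous.tendsto' (by fun_prop) _ _ (by simp)).mono_left nhdsWithin_le_nhds)
  · exact ((Continuous.tendsto' (by fun_prop) _ _ (by simp)).mono_left nhdsWithin_le_nhds)
  · have hlim : Tendsto (fun x => (3 * sinc x * cos x)⁻¹) (nhdsWithin 0 (Ioi 0))
        (nhds (1 / 3)) := by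
      have hcont : Tendsto (fun x => 3 * sinc x * cos x) (nhds 0) (nhds 3) :=
        Continuous.tendsto' (by fun_prop) _ _ (by simp)
      rw [one_div]
      exact (hcont.mono_left nhdsWithin_le_nhds).inv₀ (by norm_num)
    refine hlim.congr' ?_
    filter_upwards [hmem] with x hx
    have h0 := hx.1.ne'
    have h1 := (hs x hx).ne'
    have h2 := (hc x hx).ne'
    rw [sinc_of_ne_zero h0]
    field_simp

lemma tendsto_sin_sub_mul_cos_div_pi :
    Tendsto (fun x => (sin x - x * cos x) / sin x ^ 3) (nhdsWithin π (Iio π)) atTop := by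
  have hnum : Tendsto (fun x => sin x - x * cos x) (nhdsWithin π (Iio π)) (nhds π) :=
    (Continuous.tendsto' (by fun_prop) _ _ (by simp)).mono_left nhdsWithin_le_nhds
  have hden : Tendsto (fun x => sin x ^ 3) (nhdsWithin π (Iio π)) (nhdsWithin 0 (Ioi 0)) := by
    refine tendsto_nhdsWithin_iff.2
      ⟨(Continuous.tendsto' (by fun_prop) _ _ (by simp)).mono_left nhdsWithin_le_nhds, ?_⟩
    filter_upwards [Ioo_mem_nhdsLT pi_pos] with x hx
    exact pow_pos (sin_pos_of_mem_Ioo hx) 3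
  simp only [div_eq_mul_inv]
  exact hnum.pos_mul_atTop pi_pos hden.inv_tendsto_nhdsGT_zero

/-- The function `m(θ) = (1 - θ cot θ)/sin²θ` is positive, strictly increasing, and
convex on `(0,π)`; moreover `m(0⁺) = 1/3`, `m(π/2) = 1`, and `m(π⁻) = ∞`. -/
theorem m_pos_strictMono_convex :
    (∀ θ ∈ Ioo 0 π, 0 < (1 - θ * Real.cot θ) / Real.sin θ ^ 2) ∧
    StrictMonoOn (fun θ => (1 - θ * Real.cot θ) / Real.sin θ ^ 2) (Ioo 0 π) ∧
    ConvexOn ℝ (Ioo 0 π) (fun θ => (1 - θ * Real.cot θ) / Real.sin θ ^ 2) ∧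
    Tendsto (fun θ => (1 - θ * Real.cot θ) / Real.sin θ ^ 2)
      (nhdsWithin 0 (Ioi 0)) (nhds (1 / 3)) ∧
    (1 - π / 2 * Real.cot (π / 2)) / Real.sin (π / 2) ^ 2 = 1 ∧
    Tendsto (fun θ => (1 - θ * Real.cot θ) / Real.sin θ ^ 2)
      (nhdsWithin π (Iio π)) atTop := by
  have heq : EqOn (fun θ => (sin θ - θ * cos θ) / sin θ ^ 3)
      (fun θ => (1 - θ * Real.cot θ) / Real.sin θ ^ 2) (Ioo 0 π) := fun θ hθ =>
    (one_sub_mul_cot_div_sin_sq (sin_pos_of_mem_Ioo hθ).ne').symm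
  refine ⟨fun θ hθ => ?_, strictMonoOn_sin_sub_mul_cos_div.congr heq,
    convexOn_sin_sub_mul_cos_div.congr heq,
    tendsto_sin_sub_mul_cos_div_zero.congr' ?_, ?_,
    tendsto_sin_sub_mul_cos_div_pi.congr' ?_⟩
  · rw [one_sub_mul_cot_div_sin_sq (sin_pos_of_mem_Ioo hθ).ne']
    exact div_pos (sin_sub_mul_cos_pos θ hθ) (pow_pos (sin_pos_of_mem_Ioo hθ) 3)
  · filter_upwards [Ioo_mem_nhdsGT pi_pos] with θ hθ using heq hθ
  · simp [Real.cot_eq_cos_div_sin]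
  · filter_upwards [Ioo_mem_nhdsLT pi_pos] with θ hθ using heq hθ
end

section
/- Let n ≥ 2 and 0 < θ1 ≤ π/2. Let λ1 > 0 with y1 a first eigenfunction of the m = 0 radial problem on (0,θ1) (y1 twice continuously differentiable and strictly positive on (0,θ1), bounded near 0 with (sin θ)^{n−1} y1'(θ) → 0 as θ → 0⁺, solving −y1'' − (n−1) cot θ · y1' = λ1 y1, and y1 → 0 at θ1), and let λ2 > 0 with y2 a first eigenfunction of the m = 1 radial problem on (0,θ1) (y2 twice continuously differentiable and strictly positive on (0,θ1), solving −y2'' − (n−1) cot θ · y2' + (n−1)(sin θ)^{-2} y2 = λ2 y2, with y2 → 0 at 0 and at θ1). Define g(θ) := y2(θ)/y1(θ) and q(θ) := sin θ · g'(θ)/g(θ) on (0,θ1). Then for all θ ∈ (0,θ1): 0 ≤ q(θ) ≤ cos θ and q'(θ) ≤ 0; consequently g is increasing on (0,θ1) and B(θ) := g'(θ)² + (n−1) g(θ)²/sin²θ is decreasing on (0,θ1). -/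
open Real Set Filter

open Topology Asymptotics

section Calculus

lemma monotoneOn_Ioo_of_hasDerivAt_nonneg_s17 {a b : ℝ} {φ φ' : ℝ → ℝ}
    (h : ∀ x ∈ Ioo a b, HasDerivAt φ (φ' x) x) (h' : ∀ x ∈ Ioo a b, 0 ≤ φ' x) :
    MonotoneOn φ (Ioo a b) := by
  apply monotoneOn_of_deriv_nonneg (convex_Ioo a b)
  · exact fun x hx => (h x hx).continuousAt.continuousWithinAt
  · rw [interior_Ioo]
    exact fun x hx => (h x hx).differentiableAt.differentiableWithinAt
  · rw [interior_Ioo]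
    intro x hx
    rw [(h x hx).deriv]
    exact h' x hx

lemma antitoneOn_Ioo_of_hasDerivAt_nonpos {a b : ℝ} {φ φ' : ℝ → ℝ}
    (h : ∀ x ∈ Ioo a b, HasDerivAt φ (φ' x) x) (h' : ∀ x ∈ Ioo a b, φ' x ≤ 0) :
    AntitoneOn φ (Ioo a b) := by
  have := monotoneOn_Ioo_of_hasDerivAt_nonneg_s17 (φ := fun x => -φ x) (φ' := fun x => -φ' x)
    (fun x hx => (h x hx).neg) (fun x hx => by linarith [h' x hx])
  intro x hx y hy hxy
  linarith [this hx hy hxy]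

lemma nonneg_of_tendsto_zero_of_hasDerivAt_nonneg {a b : ℝ} {φ φ' : ℝ → ℝ}
    (h : ∀ x ∈ Ioo a b, HasDerivAt φ (φ' x) x) (h' : ∀ x ∈ Ioo a b, 0 ≤ φ' x)
    (h0 : Tendsto φ (𝓝[>] a) (𝓝 0)) : ∀ x ∈ Ioo a b, 0 ≤ φ x := by
  intro x hx
  refine le_of_tendsto h0 ?_
  filter_upwards [Ioo_mem_nhdsGT hx.1] with t ht
  exact monotoneOn_Ioo_of_hasDerivAt_nonneg_s17 h h' ⟨ht.1, ht.2.trans hx.2⟩ hx ht.2.le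

/-- A function vanishing at both ends of an interval, whose derivative is a positive multiple of
a decreasing function, is nonnegative. -/
lemma nonneg_of_tendsto_zero_of_hasDerivAt_mul_antitoneOn {a b : ℝ} {φ w S : ℝ → ℝ}
    (h : ∀ x ∈ Ioo a b, HasDerivAt φ (w x * S x) x) (hw : ∀ x ∈ Ioo a b, 0 ≤ w x)
    (hS : AntitoneOn S (Ioo a b)) (h0 : Tendsto φ (𝓝[>] a) (𝓝 0))
    (h1 : Tendsto φ (𝓝[<] b) (𝓝 0)) : ∀ x ∈ Ioo a b, 0 ≤ φ x := by
  intro x hx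
  obtain hSx | hSx := le_total 0 (S x)
  · refine le_of_tendsto h0 ?_
    filter_upwards [Ioo_mem_nhdsGT hx.1] with t ht
    have hm : MonotoneOn φ (Icc t x) := by
      have hsub : Icc t x ⊆ Ioo a b := fun z hz => ⟨ht.1.trans_le hz.1, hz.2.trans_lt hx.2⟩
      apply monotoneOn_of_deriv_nonneg (convex_Icc t x)
      · exact fun z hz => (h z (hsub hz)).continuousAt.continuousWithinAt
      · exact fun z hz =>
          (h z (hsub (interior_subset hz))).differentiableAt.differentiableWithinAt
      · intro z hz
        have hz' := interior_subset hz
        rw [(h z (hsub hz')).deriv]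
        exact mul_nonneg (hw z (hsub hz')) (hSx.trans (hS (hsub hz') hx hz'.2))
    exact hm (left_mem_Icc.2 ht.2.le) (right_mem_Icc.2 ht.2.le) ht.2.le
  · refine le_of_tendsto h1 ?_
    filter_upwards [Ioo_mem_nhdsLT hx.2] with t ht
    have hm : AntitoneOn φ (Icc x t) := by
      have hsub : Icc x t ⊆ Ioo a b := fun z hz => ⟨hx.1.trans_le hz.1, hz.2.trans_lt ht.2⟩
      apply antitoneOn_of_deriv_nonpos (convex_Icc x t)
      · exact fun z hz => (h z (hsub hz)).continuousAt.continuousWithinAt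
      · exact fun z hz =>
          (h z (hsub (interior_subset hz))).differentiableAt.differentiableWithinAt
      · intro z hz
        have hz' := interior_subset hz
        rw [(h z (hsub hz')).deriv]
        exact mul_nonpos_of_nonneg_of_nonpos (hw z (hsub hz'))
          ((hS hx (hsub hz') hz'.1).trans hSx)
    exact hm (left_mem_Icc.2 ht.1.le) (right_mem_Icc.2 ht.1.le) ht.1.le

/-- Integrating factor: if `F' = α F + r` with `r ≥ 0`, `w > 0` solves `w' = -α w` and `F w → 0`
at the left end, then `F ≥ 0`. -/
lemma nonneg_of_hasDerivAt_linear {a b : ℝ} {F α r w : ℝ → ℝ}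
    (hF : ∀ x ∈ Ioo a b, HasDerivAt F (F x * α x + r x) x) (hr : ∀ x ∈ Ioo a b, 0 ≤ r x)
    (hw : ∀ x ∈ Ioo a b, HasDerivAt w (-(α x * w x)) x) (hw0 : ∀ x ∈ Ioo a b, 0 < w x)
    (h0 : Tendsto (fun x => F x * w x) (𝓝[>] a) (𝓝 0)) : ∀ x ∈ Ioo a b, 0 ≤ F x := by
  intro x hx
  have := nonneg_of_tendsto_zero_of_hasDerivAt_nonneg (φ := fun x => F x * w x)
    (φ' := fun x => r x * w x)
    (fun x hx => ((hF x hx).mul (hw x hx)).congr_deriv (by ring))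
    (fun x hx => mul_nonneg (hr x hx) (hw0 x hx).le) h0 x hx
  exact nonneg_of_mul_nonneg_left this (hw0 x hx)

lemma not_nonneg_of_div_le_hasDerivAt {b ε : ℝ} (hb : 0 < b) (hε : 0 < ε) {φ φ' : ℝ → ℝ}
    (h : ∀ x ∈ Ioo 0 b, HasDerivAt φ (φ' x) x) (h' : ∀ x ∈ Ioo 0 b, ε / x ≤ φ' x)
    (h0 : ∀ x ∈ Ioo 0 b, 0 ≤ φ x) : False := by
  have hm : MonotoneOn (fun x => φ x - ε * log x) (Ioo 0 b) := by
    apply monotoneOn_Ioo_of_hasDerivAt_nonneg_s17 (φ' := fun x => φ' x - ε * x⁻¹)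
    · exact fun x hx => (h x hx).sub ((hasDerivAt_log hx.1.ne').const_mul ε)
    · intro x hx
      have := h' x hx
      rw [div_eq_mul_inv] at this
      linarith
  have hlog := tendsto_log_nhdsGT_zero.eventually
    (eventually_lt_atBot (-(φ (b / 2) - ε * log (b / 2)) / ε))
  obtain ⟨x, hx1, hx2⟩ := (hlog.and (Ioo_mem_nhdsGT (half_pos hb))).exists
  have hxb : x ∈ Ioo 0 b := ⟨hx2.1, by linarith [hx2.2]⟩
  have h1 := hm hxb ⟨half_pos hb, half_lt_self hb⟩ hx2.2.le
  rw [lt_div_iff₀ hε] at hx1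
  have := h0 x hxb
  simp only at h1
  linarith

/-- A bounded derivative near the right end of an interval makes the function bounded there. -/
lemma isBigO_one_of_hasDerivAt_bounded {a b C : ℝ} (hab : a < b) {φ φ' : ℝ → ℝ}
    (h : ∀ x ∈ Ioo a b, HasDerivAt φ (φ' x) x) (h' : ∀ x ∈ Ioo a b, |φ' x| ≤ C) :
    φ =O[𝓝[<] b] (fun _ => (1 : ℝ)) := by
  obtain ⟨m, hm⟩ := exists_between hab
  apply IsBigO.of_bound (|φ m| + C * (b - a))
  filter_upwards [Ioo_mem_nhdsLT hab] with x hx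
  have := (convex_Ioo a b).norm_image_sub_le_of_norm_hasDerivWithin_le
    (fun x hx => (h x hx).hasDerivWithinAt) h' hm hx
  have hC : 0 ≤ C := (abs_nonneg _).trans (h' m hm)
  have h2 : C * ‖x - m‖ ≤ C * (b - a) := by
    apply mul_le_mul_of_nonneg_left _ hC
    rw [Real.norm_eq_abs, abs_le]
    constructor <;> linarith [hx.1, hx.2, hm.1, hm.2]
  have h3 := norm_sub_norm_le (φ x) (φ m)
  simp only [norm_one, mul_one, Real.norm_eq_abs] at *
  linarith

/-- First crossing: a function going from positive to nonpositive values has a zero at which its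
derivative is nonpositive. -/
lemma exists_zero_hasDerivAt_nonpos {a b : ℝ} (hab : a < b) {φ φ' : ℝ → ℝ}
    (h : ∀ x ∈ Icc a b, HasDerivAt φ (φ' x) x) (ha : 0 < φ a) (hb : φ b ≤ 0) :
    ∃ x ∈ Ioc a b, φ x = 0 ∧ φ' x ≤ 0 := by
  have hcont : ContinuousOn φ (Icc a b) := fun x hx => (h x hx).continuousAt.continuousWithinAt
  have hclosed : IsCompact (Icc a b ∩ φ ⁻¹' Iic 0) :=
    isCompact_Icc.of_isClosed_subset (hcont.preimage_isClosed_of_isClosed isClosed_Icc isClosed_Iic)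
      inter_subset_left
  obtain ⟨x, ⟨hx, hx0⟩, hmin⟩ := hclosed.exists_isLeast ⟨b, right_mem_Icc.2 hab.le, hb⟩
  have hx0 : φ x ≤ 0 := hx0
  have hax : a < x := lt_of_le_of_ne hx.1 (by rintro rfl; linarith)
  have hpos : ∀ t ∈ Ico a x, 0 < φ t := by
    intro t ht
    by_contra hcon
    have := hmin ⟨⟨ht.1, ht.2.le.trans hx.2⟩, show φ t ≤ 0 from not_lt.1 hcon⟩
    linarith [ht.2]
  have hzero : φ x = 0 := by
    apply le_antisymm hx0
    refine ge_of_tendsto ((h x hx).continuousAt.tendsto.mono_left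
      (nhdsWithin_le_nhds (s := Iio x))) ?_
    filter_upwards [Ioo_mem_nhdsLT hax] with t ht
    exact (hpos t ⟨ht.1.le, ht.2⟩).le
  refine ⟨x, ⟨hax, hx.2⟩, hzero, ?_⟩
  refine le_of_tendsto ((hasDerivAt_iff_tendsto_slope_left_right.1 (h x hx)).1) ?_
  filter_upwards [Ioo_mem_nhdsLT hax] with t ht
  rw [slope_def_field, hzero]
  have := hpos t ⟨ht.1.le, ht.2⟩
  apply div_nonpos_of_nonneg_of_nonpos <;> linarith [ht.2]

lemma exists_zero_hasDerivAt_nonpos' {a b : ℝ} (hab : a < b) {φ φ' : ℝ → ℝ}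
    (h : ∀ x ∈ Icc a b, HasDerivAt φ (φ' x) x) (ha : 0 ≤ φ a) (hb : φ b < 0) :
    ∃ x ∈ Ico a b, φ x = 0 ∧ φ' x ≤ 0 := by
  obtain ⟨x, hx, hx0, hx'⟩ := exists_zero_hasDerivAt_nonpos (a := -b) (b := -a)
    (φ := fun x => -φ (-x)) (φ' := fun x => φ' (-x)) (by linarith)
    (fun x hx => by
      have h1 := (h (-x) ⟨by linarith [hx.2], by linarith [hx.1]⟩)
      have : HasDerivAt (fun x => -φ (-x)) (-(φ' (-x) * -1)) x :=
        (h1.comp x (hasDerivAt_neg x)).neg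
      simpa using this) (by simpa using hb) (by simpa using ha)
  refine ⟨-x, ⟨by linarith [hx.2], by linarith [hx.1]⟩, by simpa using hx0, hx'⟩

end Calculus

section Trig

lemma sin_pos_of_mem_Ioo {b x : ℝ} (hb : b ≤ π / 2) (hx : x ∈ Ioo 0 b) : 0 < sin x :=
  sin_pos_of_pos_of_lt_pi hx.1 (by linarith [hx.2, pi_pos])

lemma cos_pos_of_mem_Ioo' {b x : ℝ} (hb : b ≤ π / 2) (hx : x ∈ Ioo 0 b) : 0 < cos x :=
  cos_pos_of_mem_Ioo ⟨by linarith [hx.1, pi_pos], by linarith [hx.2]⟩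

lemma hasDerivAt_sin_pow (k : ℕ) (x : ℝ) :
    HasDerivAt (fun x => sin x ^ (k + 1)) ((k + 1) * sin x ^ k * cos x) x := by
  have : HasDerivAt (fun x => sin x ^ (k + 1)) (((k + 1 : ℕ) : ℝ) * sin x ^ k * cos x) x :=
    (hasDerivAt_sin x).pow (k + 1)
  simpa using this

lemma tendsto_sin_nhdsGT_zero : Tendsto sin (𝓝[>] 0) (𝓝 0) := by
  simpa using (continuous_sin.tendsto 0).mono_left nhdsWithin_le_nhds

lemma isBigO_one_of_abs_le_one {f : ℝ → ℝ} (l : Filter ℝ) (h : ∀ x, |f x| ≤ 1) :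
    f =O[l] (fun _ => (1 : ℝ)) :=
  IsBigO.of_bound 1 (Eventually.of_forall fun x => by simpa using h x)

lemma isBigO_one_inv_cos : (fun x => (cos x)⁻¹) =O[𝓝[>] 0] (fun _ => (1 : ℝ)) := by
  have : Tendsto (fun x => (cos x)⁻¹) (𝓝[>] 0) (𝓝 (cos 0)⁻¹) :=
    ((continuous_cos.tendsto 0).mono_left nhdsWithin_le_nhds).inv₀ (by simp)
  exact this.isBigO_one ℝ

lemma isBigO_one_mul {f g : ℝ → ℝ} {l : Filter ℝ} (hf : f =O[l] (fun _ => (1 : ℝ)))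
    (hg : g =O[l] (fun _ => (1 : ℝ))) : (fun x => f x * g x) =O[l] (fun _ => (1 : ℝ)) := by
  simpa using hf.mul hg

lemma isBigO_one_pow {f : ℝ → ℝ} {l : Filter ℝ} (hf : f =O[l] (fun _ => (1 : ℝ))) (k : ℕ) :
    (fun x => f x ^ k) =O[l] (fun _ => (1 : ℝ)) := by
  simpa using hf.pow k

lemma tendsto_zero_mul_of_isBigO_one {f g : ℝ → ℝ} {l : Filter ℝ} (hf : Tendsto f l (𝓝 0))
    (hg : g =O[l] (fun _ => (1 : ℝ))) : Tendsto (fun x => f x * g x) l (𝓝 0) := by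
  have := ((isLittleO_one_iff ℝ).2 hf).mul_isBigO hg
  simpa using (isLittleO_one_iff ℝ).1 (by simpa using this)

end Trig

section Riccati

lemma hasDerivAt_cot {x : ℝ} (hs : sin x ≠ 0) :
    HasDerivAt (fun x => cos x / sin x) (-1 / sin x ^ 2) x := by
  refine ((hasDerivAt_cos x).div (hasDerivAt_sin x) hs).congr_deriv ?_
  congr 1
  nlinarith [sin_sq_add_cos_sq x]

variable {k : ℕ} {lam b : ℝ} {p y : ℝ → ℝ}

lemma hasDerivAt_riccati {x P : ℝ} (hs : sin x ≠ 0) (hp : HasDerivAt p P x) :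
    HasDerivAt (fun x => p x ^ 2 - (k + 1) * (cos x / sin x) * p x + lam)
      (2 * p x * P - (k + 1) * (cos x / sin x * P - p x / sin x ^ 2)) x := by
  refine (((hp.pow 2).sub (((hasDerivAt_cot hs).const_mul ((k : ℝ) + 1)).mul hp)).add_const
    lam).congr_deriv ?_
  norm_num
  ring

lemma cot_riccati_identity {k lam p s c : ℝ} (hs : s ≠ 0) (hc : c ≠ 0) (h : s ^ 2 + c ^ 2 = 1)
    {R : ℝ} (hR : R = p ^ 2 - (k + 1) * (c / s) * p + lam) :
    -1 / s ^ 2 * R + c / s * (2 * p * R - (k + 1) * (c / s * R - p / s ^ 2))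
      - (R * s ^ 2 - p * (2 * s * c)) / s ^ 4 =
    (c / s * R - p / s ^ 2) * (2 * p - 2 * (s / c) - (k + 3) * (c / s))
      + 2 / c ^ 2 * (p * c / s * ((p * c - s) / s)) := by
  subst hR
  field_simp
  grind

/-- For a solution `p` of the Riccati equation with `p ≥ tan`, the function `p cot` increases. -/
lemma riccati_le_sin_mul_cos_mul (hb : b ≤ π / 2)
    (hp : ∀ x ∈ Ioo 0 b,
      HasDerivAt p (p x ^ 2 - (k + 1) * (cos x / sin x) * p x + lam) x)
    (hy : ∀ x ∈ Ioo 0 b, HasDerivAt y (-(p x * y x)) x) (hy0 : ∀ x ∈ Ioo 0 b, 0 < y x)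
    (hyb : y =O[𝓝[>] 0] (fun _ => (1 : ℝ)))
    (hpb : (fun x => p x / sin x) =O[𝓝[>] 0] (fun _ => (1 : ℝ)))
    (hpt : ∀ x ∈ Ioo 0 b, sin x ≤ p x * cos x) (hb0 : 0 < b) :
    ∀ x ∈ Ioo 0 b,
      p x ≤ sin x * cos x * (p x ^ 2 - (k + 1) * (cos x / sin x) * p x + lam) := by
  set R : ℝ → ℝ := fun x => p x ^ 2 - (k + 1) * (cos x / sin x) * p x + lam with hR
  have key : ∀ x ∈ Ioo 0 b, 0 ≤ cos x / sin x * R x - p x / sin x ^ 2 := by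
    apply nonneg_of_hasDerivAt_linear
      (α := fun x => 2 * p x - 2 * (sin x / cos x) - (k + 3) * (cos x / sin x))
      (r := fun x => 2 / cos x ^ 2 * (p x * cos x / sin x * ((p x * cos x - sin x) / sin x)))
      (w := fun x => y x ^ 2 * sin x ^ (k + 3) / cos x ^ 2)
    · intro x hx
      have hs := (sin_pos_of_mem_Ioo hb hx).ne'
      have hc := (cos_pos_of_mem_Ioo' hb hx).ne'
      refine (((hasDerivAt_cot hs).mul (hasDerivAt_riccati (lam := lam) (k := k) hs
        (hp x hx))).sub ((hp x hx).div ((hasDerivAt_sin x).pow 2) (pow_ne_zero 2 hs))).congr_deriv ?_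
      rw [← cot_riccati_identity hs hc (sin_sq_add_cos_sq x) rfl]
      norm_num
      ring
    · intro x hx
      have hs := sin_pos_of_mem_Ioo hb hx
      have hc := cos_pos_of_mem_Ioo' hb hx
      have h1 := hpt x hx
      have h2 : 0 ≤ p x * cos x := hs.le.trans h1
      have h3 : 0 ≤ p x * cos x - sin x := by linarith
      positivity
    · intro x hx
      have hs := (sin_pos_of_mem_Ioo hb hx).ne'
      have hc := (cos_pos_of_mem_Ioo' hb hx).ne'
      refine ((((hy x hx).pow 2).mul (hasDerivAt_sin_pow (k + 2) x)).div
        ((hasDerivAt_cos x).pow 2) (pow_ne_zero 2 hc)).congr_deriv ?_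
      push_cast
      simp only [Pi.pow_apply, Pi.mul_apply]
      field_simp
      ring
    · intro x hx
      have hs := sin_pos_of_mem_Ioo hb hx
      have hc := cos_pos_of_mem_Ioo' hb hx
      have := hy0 x hx
      positivity
    · have hsb := isBigO_one_of_abs_le_one (𝓝[>] 0) abs_sin_le_one
      have hcb := isBigO_one_of_abs_le_one (𝓝[>] 0) abs_cos_le_one
      have hconst : ∀ C : ℝ, (fun _ : ℝ => C) =O[𝓝[>] 0] (fun _ => (1 : ℝ)) :=
        fun C => isBigO_const_const C one_ne_zero _
      have hRb := ((isBigO_one_mul (isBigO_one_pow hsb 2) (isBigO_one_pow hpb 2)).sub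
        (isBigO_one_mul (isBigO_one_mul (hconst (k + 1)) hcb) hpb)).add (hconst lam)
      have := tendsto_zero_mul_of_isBigO_one tendsto_sin_nhdsGT_zero
        (isBigO_one_mul (isBigO_one_mul (isBigO_one_pow hsb (k + 1)) (isBigO_one_pow hyb 2))
          (isBigO_one_mul ((isBigO_one_mul hcb hRb).sub hpb) (isBigO_one_pow isBigO_one_inv_cos 2)))
      refine this.congr' ?_
      filter_upwards [Ioo_mem_nhdsGT hb0] with x hx
      have hs := (sin_pos_of_mem_Ioo hb hx).ne'
      have hc := (cos_pos_of_mem_Ioo' hb hx).ne'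
      simp only [hR]
      field_simp
      ring
  intro x hx
  have hs := sin_pos_of_mem_Ioo hb hx
  have := key x hx
  have h2 : cos x / sin x * R x - p x / sin x ^ 2 =
      (sin x * cos x * R x - p x) / sin x ^ 2 := by field_simp
  rw [h2, le_div_iff₀ (by positivity)] at this
  linarith

lemma hasDerivAt_convexity_quotient {x : ℝ} (hs : sin x ≠ 0) (hc : cos x ≠ 0) {P : ℝ}
    (hp : HasDerivAt p P x) :
    HasDerivAt (fun x => (p x ^ 2 - k * (p x * (cos x / sin x)) + lam) / cos x)
      ((2 * p x * P - k * (P * (cos x / sin x) - p x / sin x ^ 2)) / cos x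
        + sin x * (p x ^ 2 - k * (p x * (cos x / sin x)) + lam) / cos x ^ 2) x := by
  refine ((((hp.pow 2).sub ((hp.mul (hasDerivAt_cot hs)).const_mul (k : ℝ))).add_const lam).div
    (hasDerivAt_cos x) hc).congr_deriv ?_
  norm_num
  field_simp
  ring

lemma convexity_riccati_identity {k lam p s c : ℝ} (hs : s ≠ 0) (hc : c ≠ 0)
    (h : s ^ 2 + c ^ 2 = 1) {R R' J M M' : ℝ} (hR : R = p ^ 2 - (k + 1) * (c / s) * p + lam)
    (hR' : R' = 2 * p * R - (k + 1) * (c / s * R - p / s ^ 2))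
    (hM : M = p ^ 2 - k * (p * (c / s)) + lam)
    (hM' : M' = 2 * p * R - k * (R * (c / s) - p / s ^ 2)) (hJ : J = M / c) :
    (2 * R * R + 2 * p * R' - k * (R' * (c / s) - R / s ^ 2 - R / s ^ 2 + 2 * p * c / s ^ 3)) / c
      + s * M' / c ^ 2 + (c * M / c ^ 2 + s * M' / c ^ 2 + 2 * s ^ 2 * M / c ^ 3) =
    (M' / c + s * M / c ^ 2) * (2 * p - (k + 3) * (c / s) + s / c)
      + (2 * c * J ^ 2 + 2 * (k + 2) * J + J * s ^ 2 / c ^ 2 + k * p * s / c ^ 2) := by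
  subst hJ hM' hM hR' hR
  field_simp
  grind

/-- With `p` as above, `p sin` is a convex function of `sin²`. -/
lemma monotoneOn_convexity_quotient (hb : b ≤ π / 2)
    (hp : ∀ x ∈ Ioo 0 b,
      HasDerivAt p (p x ^ 2 - (k + 1) * (cos x / sin x) * p x + lam) x)
    (hy : ∀ x ∈ Ioo 0 b, HasDerivAt y (-(p x * y x)) x) (hy0 : ∀ x ∈ Ioo 0 b, 0 < y x)
    (hyb : y =O[𝓝[>] 0] (fun _ => (1 : ℝ)))
    (hpb : (fun x => p x / sin x) =O[𝓝[>] 0] (fun _ => (1 : ℝ)))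
    (hpt : ∀ x ∈ Ioo 0 b, sin x ≤ p x * cos x) (hb0 : 0 < b) :
    MonotoneOn (fun x => (p x ^ 2 - k * (p x * (cos x / sin x)) + lam) / cos x) (Ioo 0 b) := by
  set R : ℝ → ℝ := fun x => p x ^ 2 - (k + 1) * (cos x / sin x) * p x + lam with hR
  set M : ℝ → ℝ := fun x => p x ^ 2 - k * (p x * (cos x / sin x)) + lam with hM
  set M' : ℝ → ℝ := fun x =>
    2 * p x * R x - k * (R x * (cos x / sin x) - p x / sin x ^ 2) with hM'
  have hder : ∀ x ∈ Ioo 0 b, HasDerivAt (fun x => M x / cos x)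
      (M' x / cos x + sin x * M x / cos x ^ 2) x := fun x hx =>
    hasDerivAt_convexity_quotient (sin_pos_of_mem_Ioo hb hx).ne' (cos_pos_of_mem_Ioo' hb hx).ne'
      (hp x hx)
  refine monotoneOn_Ioo_of_hasDerivAt_nonneg_s17 hder ?_
  apply nonneg_of_hasDerivAt_linear
    (α := fun x => 2 * p x - (k + 3) * (cos x / sin x) + sin x / cos x)
    (r := fun x => 2 * cos x * (M x / cos x) ^ 2 + 2 * (k + 2) * (M x / cos x)
      + M x / cos x * sin x ^ 2 / cos x ^ 2 + k * p x * sin x / cos x ^ 2)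
    (w := fun x => y x ^ 2 * sin x ^ (k + 3) * cos x)
  · intro x hx
    have hs := (sin_pos_of_mem_Ioo hb hx).ne'
    have hc := (cos_pos_of_mem_Ioo' hb hx).ne'
    have hpx := hp x hx
    have hRx := hasDerivAt_riccati (lam := lam) (k := k) hs hpx
    have hct := hasDerivAt_cot hs
    have hM'x := ((hpx.const_mul 2).mul hRx).sub (((hRx.mul hct).sub
      (hpx.div ((hasDerivAt_sin x).pow 2) (pow_ne_zero 2 hs))).const_mul (k : ℝ))
    have hMx := ((hpx.pow 2).sub ((hpx.mul hct).const_mul (k : ℝ))).add_const lam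
    refine ((hM'x.div (hasDerivAt_cos x) hc).add (((hasDerivAt_sin x).mul hMx).div
      ((hasDerivAt_cos x).pow 2) (pow_ne_zero 2 hc))).congr_deriv ?_
    rw [← convexity_riccati_identity hs hc (sin_sq_add_cos_sq x) (R := R x) (M := M x) (M' := M' x)
      rfl rfl rfl rfl rfl]
    simp only [hR, hM, hM', Pi.pow_apply, Pi.mul_apply, Pi.div_apply, Pi.sub_apply]
    norm_num
    field_simp
    ring
  · intro x hx
    have hs := sin_pos_of_mem_Ioo hb hx
    have hc := cos_pos_of_mem_Ioo' hb hx
    have h1 := hpt x hx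
    have h2 : 0 ≤ p x := nonneg_of_mul_nonneg_left (hs.le.trans h1) hc
    have h3 := riccati_le_sin_mul_cos_mul hb hp hy hy0 hyb hpb hpt hb0 x hx
    have h4 : 0 ≤ R x := nonneg_of_mul_nonneg_right (h2.trans h3) (mul_pos hs hc)
    have h5 : 0 ≤ M x := by
      have : M x = R x + p x * (cos x / sin x) := by simp only [hM, hR]; ring
      rw [this]
      positivity
    positivity
  · intro x hx
    have hs := (sin_pos_of_mem_Ioo hb hx).ne'
    have hc := (cos_pos_of_mem_Ioo' hb hx).ne'
    refine ((((hy x hx).pow 2).mul (hasDerivAt_sin_pow (k + 2) x)).mul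
      (hasDerivAt_cos x)).congr_deriv ?_
    push_cast
    simp only [Pi.pow_apply, Pi.mul_apply]
    field_simp
    ring
  · intro x hx
    have hs := sin_pos_of_mem_Ioo hb hx
    have hc := cos_pos_of_mem_Ioo' hb hx
    have := hy0 x hx
    positivity
  · have hsb := isBigO_one_of_abs_le_one (𝓝[>] 0) abs_sin_le_one
    have hcb := isBigO_one_of_abs_le_one (𝓝[>] 0) abs_cos_le_one
    have hconst : ∀ C : ℝ, (fun _ : ℝ => C) =O[𝓝[>] 0] (fun _ => (1 : ℝ)) :=
      fun C => isBigO_const_const C one_ne_zero _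
    have hp2 := isBigO_one_mul (isBigO_one_pow hsb 2) (isBigO_one_pow hpb 2)
    have hcp := isBigO_one_mul hcb hpb
    have hRb := (hp2.sub (isBigO_one_mul (hconst (k + 1)) hcp)).add (hconst lam)
    have hMb := (hp2.sub (isBigO_one_mul (hconst k) hcp)).add (hconst lam)
    have hbr := ((isBigO_one_mul (isBigO_one_mul (hconst 2) (isBigO_one_pow hsb 2))
      (isBigO_one_mul hpb hRb)).sub (isBigO_one_mul (hconst k)
        ((isBigO_one_mul hcb hRb).sub hpb))).add (isBigO_one_mul (isBigO_one_pow hsb 2)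
          (isBigO_one_mul hMb isBigO_one_inv_cos))
    have := tendsto_zero_mul_of_isBigO_one tendsto_sin_nhdsGT_zero
      (isBigO_one_mul (isBigO_one_mul (isBigO_one_pow hsb (k + 1)) (isBigO_one_pow hyb 2)) hbr)
    refine this.congr' ?_
    filter_upwards [Ioo_mem_nhdsGT hb0] with x hx
    have hs := (sin_pos_of_mem_Ioo hb hx).ne'
    have hc := (cos_pos_of_mem_Ioo' hb hx).ne'
    simp only [hR, hM, hM']
    field_simp
    ring

end Riccati

section LevelSets

variable {k : ℕ} {lam b δ : ℝ} {p y q : ℝ → ℝ}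

/-- The function `2 v p sin - k v cos - (v² - (k + 1)) - δ sin²` is convex in `sin²`, so it cannot
be positive between two points where it is nonpositive. -/
lemma nonpos_of_nonpos_of_nonpos (hb : b ≤ π / 2)
    (hp : ∀ x ∈ Ioo 0 b,
      HasDerivAt p (p x ^ 2 - (k + 1) * (cos x / sin x) * p x + lam) x)
    (hJ : MonotoneOn (fun x => (p x ^ 2 - k * (p x * (cos x / sin x)) + lam) / cos x) (Ioo 0 b))
    {v : ℝ} (hv : 0 ≤ v) {T : ℝ → ℝ}
    (hT : ∀ x, T x = 2 * p x * sin x * v - k * v * cos x - (v ^ 2 - (k + 1)) - δ * sin x ^ 2)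
    {x₁ x₂ x₃ : ℝ} (hx₁ : 0 < x₁) (h12 : x₁ < x₂) (h23 : x₂ < x₃) (hx₃ : x₃ < b)
    (hT₁ : T x₁ ≤ 0) (hT₃ : T x₃ ≤ 0) : T x₂ ≤ 0 := by
  set J : ℝ → ℝ := fun x => (p x ^ 2 - k * (p x * (cos x / sin x)) + lam) / cos x with hJdef
  set H : ℝ → ℝ := fun x => 2 * v * J x + k * v / cos x - 2 * δ with hH
  have hT' : ∀ x ∈ Ioo 0 b, HasDerivAt T (sin x * cos x * H x) x := by
    intro x hx
    have hs := (sin_pos_of_mem_Ioo hb hx).ne'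
    have hc := (cos_pos_of_mem_Ioo' hb hx).ne'
    rw [funext hT]
    refine (((((((hp x hx).const_mul 2).mul (hasDerivAt_sin x)).mul_const v).sub
      ((hasDerivAt_cos x).const_mul (k * v))).sub_const _).sub
      (((hasDerivAt_sin x).pow 2).const_mul δ)).congr_deriv ?_
    simp only [hH, hJdef]
    norm_num
    field_simp
    ring
  by_contra! hcon
  obtain ⟨ξ, hξ, hξ'⟩ := exists_hasDerivAt_eq_slope T (fun x => sin x * cos x * H x) h12
    (fun x hx => (hT' x ⟨hx₁.trans_le hx.1, by linarith [hx.2]⟩).continuousAt.continuousWithinAt)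
    (fun x hx => hT' x ⟨hx₁.trans hx.1, by linarith [hx.2]⟩)
  obtain ⟨η, hη, hη'⟩ := exists_hasDerivAt_eq_slope T (fun x => sin x * cos x * H x) h23
    (fun x hx => (hT' x ⟨by linarith [hx.1], by linarith [hx.2]⟩).continuousAt.continuousWithinAt)
    (fun x hx => hT' x ⟨by linarith [hx.1], by linarith [hx.2]⟩)
  have hξm : ξ ∈ Ioo 0 b := ⟨hx₁.trans hξ.1, by linarith [hξ.2]⟩
  have hηm : η ∈ Ioo 0 b := ⟨by linarith [hη.1], by linarith [hη.2]⟩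
  have hξη : ξ ≤ η := by linarith [hξ.2, hη.1]
  have hHξ : 0 < H ξ := by
    have : 0 < sin ξ * cos ξ * H ξ := by
      rw [hξ']; exact div_pos (by linarith) (by linarith)
    exact pos_of_mul_pos_right this
      (mul_pos (sin_pos_of_mem_Ioo hb hξm) (cos_pos_of_mem_Ioo' hb hξm)).le
  have hHη : H η < 0 := by
    have : sin η * cos η * H η < 0 := by
      rw [hη']; exact div_neg_of_neg_of_pos (by linarith) (by linarith)
    exact neg_of_mul_neg_right this
      (mul_pos (sin_pos_of_mem_Ioo hb hηm) (cos_pos_of_mem_Ioo' hb hηm)).le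
  have h1 : 2 * v * J ξ ≤ 2 * v * J η := mul_le_mul_of_nonneg_left (hJ hξm hηm hξη) (by positivity)
  have h2 : k * v / cos ξ ≤ k * v / cos η := by
    apply div_le_div_of_nonneg_left (by positivity) (cos_pos_of_mem_Ioo' hb hηm)
    exact cos_le_cos_of_nonneg_of_le_pi hξm.1.le (by linarith [hηm.2, pi_pos]) hξη
  simp only [hH] at hHξ hHη
  linarith

/-- Towards the right end `q` cannot stay above a positive level. -/
lemma exists_le_of_riccati_right (hb : b ≤ π / 2)
    (hy : ∀ x ∈ Ioo 0 b, HasDerivAt y (-(p x * y x)) x) (hy0 : ∀ x ∈ Ioo 0 b, 0 < y x)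
    (hyb : Tendsto y (𝓝[<] b) (𝓝 0))
    (hp0 : ∀ x ∈ Ioo 0 b, 0 ≤ p x)
    (hq : ∀ x ∈ Ioo 0 b, HasDerivAt q ((2 * p x * sin x * q x - k * q x * cos x
      - (q x ^ 2 - (k + 1)) - δ * sin x ^ 2) / sin x) x)
    (hq0 : ∀ x ∈ Ioo 0 b, 0 ≤ q x) (hq1 : ∀ x ∈ Ioo 0 b, q x ≤ cos x)
    {v a : ℝ} (hv : 0 < v) (ha : a ∈ Ioo 0 b) : ∃ x ∈ Ioo a b, q x ≤ v := by
  by_contra! hcon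
  have hsub : ∀ x ∈ Ioo a b, x ∈ Ioo 0 b := fun x hx => ⟨ha.1.trans hx.1, hx.2⟩
  set C := (k + |δ|) / sin a with hC
  have hsa := sin_pos_of_mem_Ioo hb ha
  have hC0 : 0 ≤ C := by positivity
  have hm : MonotoneOn (fun x => q x + 2 * v * log (y x) + C * x) (Ioo a b) := by
    apply monotoneOn_Ioo_of_hasDerivAt_nonneg_s17
    · intro x hx
      exact ((hq x (hsub x hx)).add (((hy x (hsub x hx)).log (hy0 x (hsub x hx)).ne').const_mul
        (2 * v))).add ((hasDerivAt_id x).const_mul C)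
    · intro x hx
      have hx' := hsub x hx
      have hs := sin_pos_of_mem_Ioo hb hx'
      have hc := cos_pos_of_mem_Ioo' hb hx'
      have hy' := hy0 x hx'
      have hsin : sin a ≤ sin x :=
        sin_le_sin_of_le_of_le_pi_div_two (by linarith [ha.1, pi_pos]) (by linarith [hx.2]) hx.1.le
      have h1 : C * sin x ≥ k + |δ| := by
        rw [hC, div_mul_eq_mul_div, ge_iff_le, le_div_iff₀ hsa]
        exact mul_le_mul_of_nonneg_left hsin (by positivity)
      have hq1' : q x ≤ 1 := (hq1 x hx').trans (cos_le_one x)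
      have hk : (0 : ℝ) ≤ k := k.cast_nonneg
      have h2 : q x * cos x ≤ 1 := mul_le_one₀ hq1' hc.le (cos_le_one x)
      have h3 : q x ^ 2 ≤ 1 := pow_le_one₀ (hq0 x hx') hq1'
      have h4 : δ * sin x ^ 2 ≤ |δ| := by
        have : sin x ^ 2 ≤ 1 := sin_sq_le_one x
        nlinarith [le_abs_self δ, abs_nonneg δ, sq_nonneg (sin x)]
      have h5 : 0 ≤ p x * sin x * (q x - v) :=
        mul_nonneg (mul_nonneg (hp0 x hx') hs.le) (by linarith [hcon x hx])
      have h6 : k * (q x * cos x) ≤ k := mul_le_of_le_one_right hk h2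
      have : (2 * p x * sin x * q x - k * q x * cos x - (q x ^ 2 - (k + 1)) - δ * sin x ^ 2) / sin x
          + 2 * v * (-(p x * y x) / y x) + C * 1 = (2 * (p x * sin x * (q x - v))
          - k * (q x * cos x) - (q x ^ 2 - (k + 1)) - δ * sin x ^ 2 + C * sin x) / sin x := by
        field_simp
        ring
      rw [this]
      exact div_nonneg (by linarith) hs.le
  obtain ⟨m, hm1⟩ := exists_between ha.2
  have hlog : Tendsto (fun x => log (y x)) (𝓝[<] b) atBot := by
    refine tendsto_log_nhdsGT_zero.comp (tendsto_nhdsWithin_iff.2 ⟨hyb, ?_⟩)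
    filter_upwards [Ioo_mem_nhdsLT (ha.1.trans ha.2)] with x hx using hy0 x hx
  obtain ⟨x, hx1, hx2⟩ := ((hlog.eventually (eventually_lt_atBot
    ((q m + 2 * v * log (y m) + C * m - 1 - C * b) / (2 * v)))).and (Ioo_mem_nhdsLT hm1.2)).exists
  have hxa : x ∈ Ioo a b := ⟨hm1.1.trans hx2.1, hx2.2⟩
  have h1 := hm hm1 hxa hx2.1.le
  rw [lt_div_iff₀ (by positivity)] at hx1
  have h2 := (hq1 x (hsub x hxa)).trans (cos_le_one x)
  have h3 : C * x ≤ C * b := mul_le_mul_of_nonneg_left hx2.2.le hC0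
  simp only at h1
  linarith

/-- Towards the pole `q` cannot stay below a level less than one. -/
lemma exists_ge_of_riccati_left (hb : b ≤ π / 2) (hp0 : ∀ x ∈ Ioo 0 b, 0 ≤ p x)
    (hq : ∀ x ∈ Ioo 0 b, HasDerivAt q ((2 * p x * sin x * q x - k * q x * cos x
      - (q x ^ 2 - (k + 1)) - δ * sin x ^ 2) / sin x) x)
    (hq0 : ∀ x ∈ Ioo 0 b, 0 ≤ q x)
    {v a : ℝ} (hv : v < 1) (ha : a ∈ Ioo 0 b) : ∃ x ∈ Ioo 0 a, v ≤ q x := by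
  by_contra! hcon
  have hsmall : ∀ᶠ x in 𝓝[>] (0 : ℝ), |δ| * sin x ^ 2 < (1 - v) / 2 := by
    have : Tendsto (fun x => |δ| * sin x ^ 2) (𝓝[>] 0) (𝓝 (|δ| * 0 ^ 2)) :=
      (tendsto_sin_nhdsGT_zero.pow 2).const_mul _
    exact this.eventually_lt_const (by norm_num; linarith)
  obtain ⟨d, hd, hd'⟩ := (mem_nhdsGT_iff_exists_Ioo_subset).1 hsmall
  have hm : 0 < min d a := lt_min hd ha.1
  have hsub : ∀ x ∈ Ioo 0 (min d a), x ∈ Ioo 0 b :=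
    fun x hx => ⟨hx.1, (hx.2.trans_le (min_le_right _ _)).trans ha.2⟩
  refine not_nonneg_of_div_le_hasDerivAt hm (half_pos (sub_pos.2 hv))
    (fun x hx => hq x (hsub x hx)) ?_ (fun x hx => hq0 x (hsub x hx))
  intro x hx
  have hx' := hsub x hx
  have hs := sin_pos_of_mem_Ioo hb hx'
  have h1 : |δ| * sin x ^ 2 < (1 - v) / 2 := hd' ⟨hx.1, hx.2.trans_le (min_le_left _ _)⟩
  have h2 := hcon x ⟨hx.1, hx.2.trans_le (min_le_right _ _)⟩
  have h3 := hq0 x hx'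
  have hsx : sin x ≤ x := (sin_lt hx.1).le
  have hk : (0 : ℝ) ≤ k := k.cast_nonneg
  have h4 : 0 ≤ p x * sin x * q x := mul_nonneg (mul_nonneg (hp0 x hx') hs.le) h3
  have h5 : k * q x * cos x ≤ k * q x := mul_le_of_le_one_right (by positivity) (cos_le_one x)
  have h6 : δ * sin x ^ 2 ≤ |δ| * sin x ^ 2 :=
    mul_le_mul_of_nonneg_right (le_abs_self δ) (sq_nonneg _)
  have h7 : 1 - q x ≤ (1 - q x) * (q x + k + 1) := by nlinarith
  calc (1 - v) / 2 / x ≤ (1 - v) / 2 / sin x :=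
        div_le_div_of_nonneg_left (by linarith) hs hsx
    _ ≤ _ := div_le_div_of_nonneg_right (by nlinarith) hs.le

lemma riccati_rhs_nonpos (hb : b ≤ π / 2)
    (hp : ∀ x ∈ Ioo 0 b,
      HasDerivAt p (p x ^ 2 - (k + 1) * (cos x / sin x) * p x + lam) x)
    (hy : ∀ x ∈ Ioo 0 b, HasDerivAt y (-(p x * y x)) x) (hy0 : ∀ x ∈ Ioo 0 b, 0 < y x)
    (hyb : Tendsto y (𝓝[<] b) (𝓝 0)) (hp0 : ∀ x ∈ Ioo 0 b, 0 ≤ p x)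
    (hJ : MonotoneOn (fun x => (p x ^ 2 - k * (p x * (cos x / sin x)) + lam) / cos x) (Ioo 0 b))
    (hq : ∀ x ∈ Ioo 0 b, HasDerivAt q ((2 * p x * sin x * q x - k * q x * cos x
      - (q x ^ 2 - (k + 1)) - δ * sin x ^ 2) / sin x) x)
    (hq0 : ∀ x ∈ Ioo 0 b, 0 ≤ q x) (hq1 : ∀ x ∈ Ioo 0 b, q x ≤ cos x) :
    ∀ x ∈ Ioo 0 b, (2 * p x * sin x * q x - k * q x * cos x
      - (q x ^ 2 - (k + 1)) - δ * sin x ^ 2) / sin x ≤ 0 := by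
  intro x hx
  by_contra! hpos
  set v := q x with hv
  have hv1 : v < 1 := (hq1 x hx).trans_lt (by
    simpa using cos_lt_cos_of_nonneg_of_le_pi_div_two le_rfl (by linarith [hx.2]) hx.1)
  have hv0 : 0 < v := by
    refine lt_of_le_of_ne (hq0 x hx) fun h0 => ?_
    have hmin : IsLocalMin q x := by
      filter_upwards [isOpen_Ioo.mem_nhds hx] with t ht
      rw [← hv, ← h0]
      exact hq0 t ht
    exact hpos.ne' (hmin.hasDerivAt_eq_zero (hq x hx))
  have hslope := hasDerivAt_iff_tendsto_slope_left_right.1 (hq x hx)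
  obtain ⟨x₁, hx₁s, hx₁⟩ := ((hslope.1.eventually_const_lt hpos).and
    (Ioo_mem_nhdsLT hx.1)).exists
  obtain ⟨x₃, hx₃s, hx₃⟩ := ((hslope.2.eventually_const_lt hpos).and
    (Ioo_mem_nhdsGT hx.2)).exists
  have hqx₁ : q x₁ - v < 0 := by
    rw [slope_def_field, div_pos_iff] at hx₁s
    rcases hx₁s with h | h <;> linarith [hx₁.2, h.1, h.2]
  have hqx₃ : 0 < q x₃ - v := by
    rw [slope_def_field, div_pos_iff] at hx₃s
    rcases hx₃s with h | h <;> linarith [hx₃.1, h.1, h.2]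
  obtain ⟨a, ha, hqa⟩ := exists_ge_of_riccati_left hb hp0 hq hq0 hv1
    (a := x₁) ⟨hx₁.1, hx₁.2.trans hx.2⟩
  obtain ⟨c, hc, hqc⟩ := exists_le_of_riccati_right hb hy hy0 hyb hp0 hq hq0 hq1 hv0
    (a := x₃) ⟨hx.1.trans hx₃.1, hx₃.2⟩
  obtain ⟨ξ, hξ, hqξ, hξ'⟩ := exists_zero_hasDerivAt_nonpos' ha.2 (φ := fun t => q t - v)
    (fun t ht => (hq t ⟨ha.1.trans_le ht.1, by linarith [ht.2, hx₁.2, hx.2]⟩).sub_const v)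
    (by simpa using hqa) hqx₁
  obtain ⟨η, hη, hqη, hη'⟩ := exists_zero_hasDerivAt_nonpos hc.1 (φ := fun t => q t - v)
    (fun t ht => (hq t ⟨by linarith [ht.1, hx₃.1, hx.1], ht.2.trans_lt hc.2⟩).sub_const v)
    hqx₃ (by simpa using hqc)
  have hξb : ξ ∈ Ioo 0 b := ⟨ha.1.trans_le hξ.1, by linarith [hξ.2, hx₁.2, hx.2]⟩
  have hηb : η ∈ Ioo 0 b := ⟨by linarith [hη.1, hx₃.1, hx.1], hη.2.trans_lt hc.2⟩
  have hnonpos : ∀ t ∈ Ioo 0 b, ∀ A : ℝ, A / sin t ≤ 0 → A ≤ 0 := fun t ht A hA => by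
    by_contra! h
    exact absurd (div_pos h (sin_pos_of_mem_Ioo hb ht)) hA.not_gt
  rw [sub_eq_zero.1 hqξ] at hξ'
  rw [sub_eq_zero.1 hqη] at hη'
  have := nonpos_of_nonpos_of_nonpos hb hp hJ hv0.le (δ := δ) (fun _ => rfl) hξb.1
    (x₂ := x) (by linarith [hξ.2, hx₁.2]) (by linarith [hη.1, hx₃.1]) hηb.2
    (hnonpos ξ hξb _ hξ') (hnonpos η hηb _ hη')
  exact absurd (div_nonpos_of_nonpos_of_nonneg this (sin_pos_of_mem_Ioo hb hx).le) hpos.not_ge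

end LevelSets

section RadialEquation

variable {k : ℕ} {lam b : ℝ} {y y' V : ℝ → ℝ}

lemma hasDerivAt_sin_pow_mul {x : ℝ} (hs : sin x ≠ 0)
    (hy' : HasDerivAt y' (-((k + 1) * (cos x / sin x) * y' x) - V x * y x) x) :
    HasDerivAt (fun x => sin x ^ (k + 1) * y' x) (-(sin x ^ (k + 1) * V x * y x)) x := by
  refine ((hasDerivAt_sin_pow k x).mul hy').congr_deriv ?_
  field_simp
  ring

lemma isBigO_one_sin_pow_mul_deriv (hb0 : 0 < b) (hb : b ≤ π / 2)
    (hy' : ∀ x ∈ Ioo 0 b,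
      HasDerivAt y' (-((k + 1) * (cos x / sin x) * y' x) - V x * y x) x)
    (hyb : Tendsto y (𝓝[<] b) (𝓝 0)) (hV : ContinuousAt V b) :
    (fun x => sin x ^ (k + 1) * y' x) =O[𝓝[<] b] (fun _ => (1 : ℝ)) := by
  have hbd : (fun x => sin x ^ (k + 1) * V x * y x) =O[𝓝[<] b] (fun _ => (1 : ℝ)) :=
    isBigO_one_mul (isBigO_one_mul
      (isBigO_one_pow (isBigO_one_of_abs_le_one _ abs_sin_le_one) (k + 1))
      ((hV.tendsto.mono_left nhdsWithin_le_nhds).isBigO_one ℝ)) (hyb.isBigO_one ℝ)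
  obtain ⟨C, hC⟩ := hbd.bound
  obtain ⟨a, ha, ha'⟩ := (mem_nhdsLT_iff_exists_Ioo_subset).1 hC
  refine isBigO_one_of_hasDerivAt_bounded (a := max a 0) (C := C)
    (φ' := fun x => -(sin x ^ (k + 1) * V x * y x)) (max_lt ha hb0) (fun x hx => ?_) (fun x hx => ?_)
  · have hx' : x ∈ Ioo 0 b := ⟨(le_max_right _ _).trans_lt hx.1, hx.2⟩
    exact hasDerivAt_sin_pow_mul (sin_pos_of_mem_Ioo hb hx').ne' (hy' x hx')
  · have := ha' ⟨(le_max_left _ _).trans_lt hx.1, hx.2⟩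
    simpa using this

/-- A positive solution of the `m = 1` equation vanishing at the pole has vanishing flux there. -/
lemma tendsto_sin_pow_mul_deriv_zero (hb0 : 0 < b) (hb : b ≤ π / 2)
    (hy : ∀ x ∈ Ioo 0 b, HasDerivAt y (y' x) x) (hpos : ∀ x ∈ Ioo 0 b, 0 < y x)
    (hy' : ∀ x ∈ Ioo 0 b, HasDerivAt y' (-((k + 1) * (cos x / sin x) * y' x)
      - (lam - (k + 1) / sin x ^ 2) * y x) x)
    (hy0 : Tendsto y (𝓝[>] 0) (𝓝 0)) :
    Tendsto (fun x => sin x ^ (k + 1) * y' x) (𝓝[>] 0) (𝓝 0) := by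
  have hsmall : ∀ᶠ x in 𝓝[>] (0 : ℝ), lam * sin x ^ 2 < 1 := by
    have : Tendsto (fun x => lam * sin x ^ 2) (𝓝[>] 0) (𝓝 (lam * 0 ^ 2)) :=
      (tendsto_sin_nhdsGT_zero.pow 2).const_mul _
    exact this.eventually_lt_const (by norm_num)
  obtain ⟨d, hd, hd'⟩ := (mem_nhdsGT_iff_exists_Ioo_subset).1 hsmall
  set m := min d b with hm
  have hm0 : 0 < m := lt_min hd hb0
  have hsub : ∀ x ∈ Ioo 0 m, x ∈ Ioo 0 b := fun x hx => ⟨hx.1, hx.2.trans_le (min_le_right _ _)⟩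
  have hmono : MonotoneOn (fun x => sin x ^ (k + 1) * y' x) (Ioo 0 m) := by
    refine monotoneOn_Ioo_of_hasDerivAt_nonneg_s17 (fun x hx => hasDerivAt_sin_pow_mul
      (V := fun x => lam - (k + 1) / sin x ^ 2)
      (sin_pos_of_mem_Ioo hb (hsub x hx)).ne' (hy' x (hsub x hx))) (fun x hx => ?_)
    have hs := sin_pos_of_mem_Ioo hb (hsub x hx)
    have h1 : lam * sin x ^ 2 < 1 := hd' ⟨hx.1, hx.2.trans_le (min_le_left _ _)⟩
    have h2 : lam - (k + 1) / sin x ^ 2 ≤ 0 := by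
      rw [sub_nonpos, le_div_iff₀ (by positivity)]
      linarith [(Nat.cast_nonneg k : (0 : ℝ) ≤ k)]
    have h3 := mul_nonneg (mul_nonneg (pow_nonneg hs.le (k + 1)) (neg_nonneg.2 h2))
      (hpos x (hsub x hx)).le
    linarith
  have hnonneg : ∀ x ∈ Ioo 0 m, 0 ≤ sin x ^ (k + 1) * y' x := by
    intro x hx
    by_contra! hneg
    have hanti : AntitoneOn y (Ioo 0 x) := by
      refine antitoneOn_Ioo_of_hasDerivAt_nonpos
        (fun t ht => hy t (hsub t ⟨ht.1, ht.2.trans hx.2⟩)) (fun t ht => ?_)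
      have htm : t ∈ Ioo 0 m := ⟨ht.1, ht.2.trans hx.2⟩
      have h1 : sin t ^ (k + 1) * y' t ≤ sin x ^ (k + 1) * y' x := hmono htm hx ht.2.le
      exact (neg_of_mul_neg_right (h1.trans_lt hneg)
        (pow_pos (sin_pos_of_mem_Ioo hb (hsub t htm)) _).le).le
    have hx2 : x / 2 ∈ Ioo 0 x := ⟨half_pos hx.1, half_lt_self hx.1⟩
    have : y (x / 2) ≤ 0 := by
      refine ge_of_tendsto hy0 ?_
      filter_upwards [Ioo_mem_nhdsGT hx2.1] with t ht
      exact hanti ⟨ht.1, ht.2.trans hx2.2⟩ hx2 ht.2.le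
    exact absurd (hpos _ (hsub _ ⟨hx2.1, hx2.2.trans hx.2⟩)) this.not_gt
  rw [tendsto_order]
  refine ⟨fun ε hε => ?_, fun ε hε => ?_⟩
  · filter_upwards [Ioo_mem_nhdsGT hm0] with x hx
    exact hε.trans_le (hnonneg x hx)
  · have hex : ∃ x ∈ Ioo 0 m, sin x ^ (k + 1) * y' x < ε := by
      by_contra! hcon
      refine not_nonneg_of_div_le_hasDerivAt hm0 hε (fun x hx => hy x (hsub x hx))
        (fun x hx => ?_) (fun x hx => (hpos x (hsub x hx)).le)
      have hs := sin_pos_of_mem_Ioo hb (hsub x hx)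
      have h1 : sin x ^ (k + 1) ≤ x :=
        (pow_le_of_le_one hs.le (sin_le_one x) k.succ_ne_zero).trans (sin_lt hx.1).le
      have h2 := hcon x hx
      have h3 : 0 < y' x := pos_of_mul_pos_right (hε.trans_le h2) (pow_nonneg hs.le _)
      rw [div_le_iff₀ hx.1]
      nlinarith
    obtain ⟨x, hx, hxε⟩ := hex
    filter_upwards [Ioo_mem_nhdsGT hx.1] with t ht
    exact (hmono ⟨ht.1, ht.2.trans hx.2⟩ hx ht.2.le).trans_lt hxε

lemma deriv_nonpos_of_radial (hb : b ≤ π / 2) (hlam : 0 ≤ lam)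
    (hpos : ∀ x ∈ Ioo 0 b, 0 < y x)
    (hy' : ∀ x ∈ Ioo 0 b,
      HasDerivAt y' (-((k + 1) * (cos x / sin x) * y' x) - lam * y x) x)
    (h0 : Tendsto (fun x => sin x ^ (k + 1) * y' x) (𝓝[>] 0) (𝓝 0)) :
    ∀ x ∈ Ioo 0 b, y' x ≤ 0 := by
  intro x hx
  have := nonneg_of_tendsto_zero_of_hasDerivAt_nonneg
    (φ := fun x => -(sin x ^ (k + 1) * y' x))
    (fun x hx => (hasDerivAt_sin_pow_mul (V := fun _ => lam) (sin_pos_of_mem_Ioo hb hx).ne'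
      (hy' x hx)).neg)
    (fun x hx => by
      have hs := sin_pos_of_mem_Ioo hb hx
      have := hpos x hx
      rw [neg_neg]
      positivity) (by simpa using h0.neg) x hx
  have hs := pow_pos (sin_pos_of_mem_Ioo hb hx) (k + 1)
  by_contra! h
  have := mul_pos hs h
  linarith

/-- The logarithmic derivative of a positive solution vanishing at the boundary dominates that of
`cos`. -/
lemma sin_mul_add_cos_mul_deriv_nonpos (hb : b ≤ π / 2) (hlam : 0 ≤ lam)
    (hy : ∀ x ∈ Ioo 0 b, HasDerivAt y (y' x) x) (hpos : ∀ x ∈ Ioo 0 b, 0 < y x)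
    (hy' : ∀ x ∈ Ioo 0 b,
      HasDerivAt y' (-((k + 1) * (cos x / sin x) * y' x) - lam * y x) x)
    (hy0 : y =O[𝓝[>] 0] (fun _ => (1 : ℝ)))
    (h0 : Tendsto (fun x => sin x ^ (k + 1) * y' x) (𝓝[>] 0) (𝓝 0))
    (hyb : Tendsto y (𝓝[<] b) (𝓝 0)) :
    ∀ x ∈ Ioo 0 b, sin x * y x + cos x * y' x ≤ 0 := by
  have hcb := isBigO_one_of_abs_le_one (𝓝[>] 0) abs_cos_le_one
  have hsb := isBigO_one_of_abs_le_one (𝓝[>] 0) abs_sin_le_one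
  have hder : ∀ x ∈ Ioo 0 b, HasDerivAt
      (fun x => sin x ^ (k + 1) * y' x * cos x + sin x ^ (k + 2) * y x)
      (sin x ^ (k + 1) * cos x * y x * (k + 2 - lam)) x := by
    intro x hx
    refine (((hasDerivAt_sin_pow_mul (V := fun _ => lam) (sin_pos_of_mem_Ioo hb hx).ne'
      (hy' x hx)).mul (hasDerivAt_cos x)).add
      ((hasDerivAt_sin_pow (k + 1) x).mul (hy x hx))).congr_deriv ?_
    push_cast
    ring
  have hlim : Tendsto (fun x => sin x ^ (k + 1) * y' x * cos x + sin x ^ (k + 2) * y x)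
      (𝓝[>] 0) (𝓝 0) := by
    have h1 := tendsto_zero_mul_of_isBigO_one h0 hcb
    have h2 := tendsto_zero_mul_of_isBigO_one tendsto_sin_nhdsGT_zero
      (isBigO_one_mul (isBigO_one_pow hsb (k + 1)) hy0)
    have h3 := h1.add h2
    rw [add_zero] at h3
    exact h3.congr fun x => by ring
  have hweight : ∀ x ∈ Ioo 0 b, 0 ≤ sin x ^ (k + 1) * cos x * y x := fun x hx => by
    have := sin_pos_of_mem_Ioo hb hx
    have := cos_pos_of_mem_Ioo' hb hx
    have := hpos x hx
    positivity
  have key : ∀ x ∈ Ioo 0 b, sin x ^ (k + 1) * y' x * cos x + sin x ^ (k + 2) * y x ≤ 0 := by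
    intro x hx
    obtain h | h := le_total (k + 2 - lam) 0
    · have := nonneg_of_tendsto_zero_of_hasDerivAt_nonneg
        (φ := fun x => -(sin x ^ (k + 1) * y' x * cos x + sin x ^ (k + 2) * y x))
        (fun x hx => (hder x hx).neg)
        (fun x hx => neg_nonneg.2 (mul_nonpos_of_nonneg_of_nonpos (hweight x hx) h))
        (by have := hlim.neg; rwa [neg_zero] at this) x hx
      linarith
    · have hmono := monotoneOn_Ioo_of_hasDerivAt_nonneg_s17 hder
        (fun x hx => mul_nonneg (hweight x hx) h)
      refine ge_of_tendsto hyb ?_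
      filter_upwards [Ioo_mem_nhdsLT hx.2] with t ht
      have htb : t ∈ Ioo 0 b := ⟨hx.1.trans ht.1, ht.2⟩
      refine (hmono hx htb ht.1.le).trans ?_
      have hs := sin_pos_of_mem_Ioo hb htb
      have h1 : sin t ^ (k + 1) * y' t * cos t ≤ 0 :=
        mul_nonpos_of_nonpos_of_nonneg (mul_nonpos_of_nonneg_of_nonpos (by positivity)
          (deriv_nonpos_of_radial hb hlam hpos hy' h0 t htb)) (cos_pos_of_mem_Ioo' hb htb).le
      have h2 : sin t ^ (k + 2) * y t ≤ y t :=
        mul_le_of_le_one_left (hpos t htb).le (pow_le_one₀ hs.le (sin_le_one t))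
      simp only
      linarith
  intro x hx
  have h1 := key x hx
  by_contra! h
  have := mul_pos (pow_pos (sin_pos_of_mem_Ioo hb hx) (k + 1)) h
  have h2 : sin x ^ (k + 1) * (sin x * y x + cos x * y' x) =
    sin x ^ (k + 1) * y' x * cos x + sin x ^ (k + 2) * y x := by ring
  linarith

lemma isBigO_one_neg_logDeriv_div_sin (hb0 : 0 < b) (hb : b ≤ π / 2) (hlam : 0 ≤ lam)
    (hy : ∀ x ∈ Ioo 0 b, HasDerivAt y (y' x) x) (hpos : ∀ x ∈ Ioo 0 b, 0 < y x)
    (hy' : ∀ x ∈ Ioo 0 b,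
      HasDerivAt y' (-((k + 1) * (cos x / sin x) * y' x) - lam * y x) x)
    (hy0 : y =O[𝓝[>] 0] (fun _ => (1 : ℝ)))
    (h0 : Tendsto (fun x => sin x ^ (k + 1) * y' x) (𝓝[>] 0) (𝓝 0)) :
    (fun x => -(y' x / y x) / sin x) =O[𝓝[>] 0] (fun _ => (1 : ℝ)) := by
  obtain ⟨M, hM⟩ := hy0.bound
  obtain ⟨d, hd, hd'⟩ := (mem_nhdsGT_iff_exists_Ioo_subset).1 hM
  have hneg := deriv_nonpos_of_radial hb hlam hpos hy' h0
  set m := min d b with hm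
  have hm0 : 0 < m := lt_min hd hb0
  have hsub : ∀ x ∈ Ioo 0 m, x ∈ Ioo 0 b := fun x hx => ⟨hx.1, hx.2.trans_le (min_le_right _ _)⟩
  have hyM : ∀ x ∈ Ioo 0 m, y x ≤ M := fun x hx => by
    have : ‖y x‖ ≤ M * ‖(1 : ℝ)‖ := hd' ⟨hx.1, hx.2.trans_le (min_le_left _ _)⟩
    simp only [norm_one, mul_one] at this
    exact (le_abs_self _).trans this
  have hflux : ∀ x ∈ Ioo 0 m,
      0 ≤ sin x ^ (k + 1) * y' x + lam * M * (x * sin x ^ (k + 1)) := by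
    apply nonneg_of_tendsto_zero_of_hasDerivAt_nonneg
    · intro x hx
      exact (hasDerivAt_sin_pow_mul (V := fun _ => lam) (sin_pos_of_mem_Ioo hb (hsub x hx)).ne'
        (hy' x (hsub x hx))).add (((hasDerivAt_id x).mul (hasDerivAt_sin_pow k x)).const_mul _)
    · intro x hx
      have hs := sin_pos_of_mem_Ioo hb (hsub x hx)
      have hc := cos_pos_of_mem_Ioo' hb (hsub x hx)
      have hyx := hpos x (hsub x hx)
      have hMy := hyM x hx
      have hM0 : 0 ≤ M := hyx.le.trans hMy
      have hx0 := hx.1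
      have h1 : sin x ^ (k + 1) * lam * y x ≤ sin x ^ (k + 1) * lam * M := by gcongr
      have h2 : 0 ≤ lam * M * (x * ((k + 1) * sin x ^ k * cos x)) := by positivity
      simp only [id]
      linarith
    · have h1 : Tendsto (fun x : ℝ => x * sin x ^ (k + 1)) (𝓝[>] 0) (𝓝 0) :=
        tendsto_zero_mul_of_isBigO_one (tendsto_id.mono_left nhdsWithin_le_nhds)
          (isBigO_one_pow (isBigO_one_of_abs_le_one _ abs_sin_le_one) (k + 1))
      simpa using h0.add (h1.const_mul (lam * M))
  have hm2 : m / 2 ∈ Ioo 0 m := ⟨half_pos hm0, half_lt_self hm0⟩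
  have hym := hpos _ (hsub _ hm2)
  apply IsBigO.of_bound (lam * M * (π / 2) / y (m / 2))
  filter_upwards [Ioo_mem_nhdsGT hm2.1] with x hx
  have hxm : x ∈ Ioo 0 m := ⟨hx.1, hx.2.trans hm2.2⟩
  have hs := sin_pos_of_mem_Ioo hb (hsub x hxm)
  have hyx := hpos x (hsub x hxm)
  have hM0 : 0 ≤ M := hyx.le.trans (hyM x hxm)
  have h1 : -y' x ≤ lam * M * x := by
    have := hflux x hxm
    by_contra! h
    have := mul_pos (pow_pos hs (k + 1)) (sub_pos.2 h)
    linarith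
  have h2 : y (m / 2) ≤ y x := antitoneOn_Ioo_of_hasDerivAt_nonpos hy hneg (hsub x hxm)
    (hsub _ hm2) hx.2.le
  have h3 : x ≤ π / 2 * sin x := by
    have := mul_le_sin hx.1.le (by linarith [(hsub x hxm).2])
    have h4 : π / 2 * (2 / π * x) = x := by field_simp
    have := mul_le_mul_of_nonneg_left this (show 0 ≤ π / 2 by positivity)
    linarith
  have h4 : 0 ≤ -(y' x / y x) / sin x := by
    rw [← neg_div]
    have := neg_nonneg.2 (hneg x (hsub x hxm))
    positivity
  rw [Real.norm_eq_abs, abs_of_nonneg h4, norm_one, mul_one, div_le_iff₀ hs, ← neg_div,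
    div_le_iff₀ hyx]
  calc -y' x ≤ lam * M * (π / 2 * sin x) :=
        h1.trans (mul_le_mul_of_nonneg_left h3 (by positivity))
    _ = lam * M * (π / 2) / y (m / 2) * sin x * y (m / 2) := by field_simp
    _ ≤ _ := mul_le_mul_of_nonneg_left h2 (by positivity)

lemma hasDerivAt_neg_logDeriv {x : ℝ} (hy : HasDerivAt y (y' x) x) (hpos : 0 < y x)
    (hy' : HasDerivAt y' (-((k + 1) * (cos x / sin x) * y' x) - lam * y x) x) :
    HasDerivAt (fun x => -(y' x / y x))
      ((-(y' x / y x)) ^ 2 - (k + 1) * (cos x / sin x) * -(y' x / y x) + lam) x := by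
  refine (hy'.div hy hpos.ne').neg.congr_deriv ?_
  field_simp
  ring

end RadialEquation

section TwoModes

variable {k : ℕ} {lam1 lam2 b : ℝ} {y1 y1' y2 y2' : ℝ → ℝ}

lemma hasDerivAt_wronskian {x : ℝ} (hs : sin x ≠ 0)
    (h1 : HasDerivAt y1 (y1' x) x) (h2 : HasDerivAt y2 (y2' x) x)
    (h1' : HasDerivAt y1' (-((k + 1) * (cos x / sin x) * y1' x) - lam1 * y1 x) x)
    (h2' : HasDerivAt y2' (-((k + 1) * (cos x / sin x) * y2' x)
      - (lam2 - (k + 1) / sin x ^ 2) * y2 x) x) :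
    HasDerivAt (fun x => sin x ^ (k + 1) * y2' x * y1 x - sin x ^ (k + 1) * y1' x * y2 x)
      (sin x ^ (k + 1) * y1 x * y2 x * ((k + 1) / sin x ^ 2 - (lam2 - lam1))) x := by
  refine (((hasDerivAt_sin_pow_mul (V := fun x => lam2 - (k + 1) / sin x ^ 2) hs h2').mul h1).sub
    ((hasDerivAt_sin_pow_mul (V := fun _ => lam1) hs h1').mul h2)).congr_deriv ?_
  ring

lemma hasDerivAt_cos_mul_sub_wronskian {x : ℝ} (hs : sin x ≠ 0) (hy1 : y1 x ≠ 0)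
    (h1 : HasDerivAt y1 (y1' x) x) (h2 : HasDerivAt y2 (y2' x) x)
    (h1' : HasDerivAt y1' (-((k + 1) * (cos x / sin x) * y1' x) - lam1 * y1 x) x)
    (h2' : HasDerivAt y2' (-((k + 1) * (cos x / sin x) * y2' x)
      - (lam2 - (k + 1) / sin x ^ 2) * y2 x) x) :
    HasDerivAt (fun x => sin x ^ (k + 1) * (cos x * y1 x * y2 x)
        - sin x * (sin x ^ (k + 1) * y2' x * y1 x - sin x ^ (k + 1) * y1' x * y2 x))
      (sin x ^ (k + 2) * y1 x * y2 x
        * (lam2 - lam1 - (k + 2) - 2 * (-(y1' x / y1 x) * (cos x / sin x)))) x := by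
  refine (((hasDerivAt_sin_pow k x).mul (((hasDerivAt_cos x).mul h1).mul h2)).sub
    ((hasDerivAt_sin x).mul (hasDerivAt_wronskian hs h1 h2 h1' h2'))).congr_deriv ?_
  field_simp
  simp only [Pi.mul_apply]
  have h := cos_sq' x
  linear_combination (sin x * sin x ^ k * y1 x * y2 x * (k + 1)) * h

/-- The Wronskian of the two first modes is nonnegative. -/
lemma wronskian_nonneg (hb0 : 0 < b) (hb : b ≤ π / 2)
    (h1 : ∀ x ∈ Ioo 0 b, HasDerivAt y1 (y1' x) x)
    (h2 : ∀ x ∈ Ioo 0 b, HasDerivAt y2 (y2' x) x)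
    (h1' : ∀ x ∈ Ioo 0 b,
      HasDerivAt y1' (-((k + 1) * (cos x / sin x) * y1' x) - lam1 * y1 x) x)
    (h2' : ∀ x ∈ Ioo 0 b, HasDerivAt y2' (-((k + 1) * (cos x / sin x) * y2' x)
      - (lam2 - (k + 1) / sin x ^ 2) * y2 x) x)
    (hpos1 : ∀ x ∈ Ioo 0 b, 0 < y1 x) (hpos2 : ∀ x ∈ Ioo 0 b, 0 < y2 x)
    (hl0 : Tendsto (fun x => sin x ^ (k + 1) * y2' x * y1 x - sin x ^ (k + 1) * y1' x * y2 x)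
      (𝓝[>] 0) (𝓝 0))
    (hl1 : Tendsto (fun x => sin x ^ (k + 1) * y2' x * y1 x - sin x ^ (k + 1) * y1' x * y2 x)
      (𝓝[<] b) (𝓝 0)) :
    ∀ x ∈ Ioo 0 b, 0 ≤ sin x ^ (k + 1) * y2' x * y1 x - sin x ^ (k + 1) * y1' x * y2 x := by
  refine nonneg_of_tendsto_zero_of_hasDerivAt_mul_antitoneOn
    (fun x hx => hasDerivAt_wronskian (sin_pos_of_mem_Ioo hb hx).ne' (h1 x hx) (h2 x hx)
      (h1' x hx) (h2' x hx))
    (fun x hx => ?_) ?_ hl0 hl1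
  · have := sin_pos_of_mem_Ioo hb hx
    have := hpos1 x hx
    have := hpos2 x hx
    positivity
  · intro x hx z hz hxz
    have hs := sin_pos_of_mem_Ioo hb hx
    have : sin x ≤ sin z :=
      sin_le_sin_of_le_of_le_pi_div_two (by linarith [hx.1, pi_pos]) (hz.2.le.trans hb) hxz
    simp only
    gcongr

lemma cos_mul_sub_wronskian_nonneg (hb : b ≤ π / 2)
    (h1 : ∀ x ∈ Ioo 0 b, HasDerivAt y1 (y1' x) x)
    (h2 : ∀ x ∈ Ioo 0 b, HasDerivAt y2 (y2' x) x)
    (h1' : ∀ x ∈ Ioo 0 b,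
      HasDerivAt y1' (-((k + 1) * (cos x / sin x) * y1' x) - lam1 * y1 x) x)
    (h2' : ∀ x ∈ Ioo 0 b, HasDerivAt y2' (-((k + 1) * (cos x / sin x) * y2' x)
      - (lam2 - (k + 1) / sin x ^ 2) * y2 x) x)
    (hpos1 : ∀ x ∈ Ioo 0 b, 0 < y1 x) (hpos2 : ∀ x ∈ Ioo 0 b, 0 < y2 x)
    (hpcot : MonotoneOn (fun x => -(y1' x / y1 x) * (cos x / sin x)) (Ioo 0 b))
    (hl0 : Tendsto (fun x => sin x ^ (k + 1) * y2' x * y1 x - sin x ^ (k + 1) * y1' x * y2 x)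
      (𝓝[>] 0) (𝓝 0))
    (hl1 : Tendsto (fun x => sin x ^ (k + 1) * y2' x * y1 x - sin x ^ (k + 1) * y1' x * y2 x)
      (𝓝[<] b) (𝓝 0))
    (hm0 : Tendsto (fun x => y2 x * y1 x) (𝓝[>] 0) (𝓝 0))
    (hm1 : Tendsto (fun x => y2 x * y1 x) (𝓝[<] b) (𝓝 0)) :
    ∀ x ∈ Ioo 0 b, 0 ≤ sin x ^ (k + 1) * (cos x * y1 x * y2 x)
        - sin x * (sin x ^ (k + 1) * y2' x * y1 x - sin x ^ (k + 1) * y1' x * y2 x) := by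
  have hlim : ∀ l : Filter ℝ, Tendsto (fun x => y2 x * y1 x) l (𝓝 0) →
      Tendsto (fun x => sin x ^ (k + 1) * y2' x * y1 x - sin x ^ (k + 1) * y1' x * y2 x) l (𝓝 0) →
      Tendsto (fun x => sin x ^ (k + 1) * (cos x * y1 x * y2 x)
        - sin x * (sin x ^ (k + 1) * y2' x * y1 x - sin x ^ (k + 1) * y1' x * y2 x)) l (𝓝 0) := by
    intro l hm hl
    have hsb := isBigO_one_of_abs_le_one l abs_sin_le_one
    have h := (tendsto_zero_mul_of_isBigO_one hm (isBigO_one_mul (isBigO_one_pow hsb (k + 1))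
      (isBigO_one_of_abs_le_one l abs_cos_le_one))).sub (tendsto_zero_mul_of_isBigO_one hl hsb)
    rw [sub_zero] at h
    exact h.congr fun x => by ring
  refine nonneg_of_tendsto_zero_of_hasDerivAt_mul_antitoneOn
    (fun x hx => hasDerivAt_cos_mul_sub_wronskian (sin_pos_of_mem_Ioo hb hx).ne'
      (hpos1 x hx).ne' (h1 x hx) (h2 x hx) (h1' x hx) (h2' x hx))
    (fun x hx => ?_) (fun x hx z hz hxz => ?_) (hlim _ hm0 hl0) (hlim _ hm1 hl1)
  · have := sin_pos_of_mem_Ioo hb hx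
    have := hpos1 x hx
    have := hpos2 x hx
    positivity
  · have := hpcot hx hz hxz
    simp only at this ⊢
    linarith

lemma hasDerivAt_sin_mul_logDeriv_div {x : ℝ} (hs : sin x ≠ 0) (hy1 : y1 x ≠ 0) (hy2 : y2 x ≠ 0)
    (h1 : HasDerivAt y1 (y1' x) x) (h2 : HasDerivAt y2 (y2' x) x)
    (h1' : HasDerivAt y1' (-((k + 1) * (cos x / sin x) * y1' x) - lam1 * y1 x) x)
    (h2' : HasDerivAt y2' (-((k + 1) * (cos x / sin x) * y2' x)
      - (lam2 - (k + 1) / sin x ^ 2) * y2 x) x) {q : ℝ → ℝ}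
    (hq : ∀ᶠ t in 𝓝 x, q t = sin t * (y2' t / y2 t - y1' t / y1 t)) :
    HasDerivAt q ((2 * -(y1' x / y1 x) * sin x * q x - k * q x * cos x
      - (q x ^ 2 - (k + 1)) - (lam2 - lam1) * sin x ^ 2) / sin x) x := by
  refine HasDerivAt.congr_of_eventuallyEq (HasDerivAt.congr_deriv
    ((hasDerivAt_sin x).mul ((h2'.div h2 hy2).sub (h1'.div h1 hy1))) ?_) hq
  rw [hq.self_of_nhds]
  simp only [Pi.sub_apply, Pi.div_apply]
  field_simp
  ring

end TwoModes

lemma hasDerivAt_of_contDiffOn_two {y : ℝ → ℝ} {a b : ℝ} (h : ContDiffOn ℝ 2 y (Ioo a b)) :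
    (∀ x ∈ Ioo a b, HasDerivAt y (deriv y x) x) ∧
      ∀ x ∈ Ioo a b, HasDerivAt (deriv y) (deriv (deriv y) x) x := by
  have h' : ContDiffOn ℝ 1 (deriv y) (Ioo a b) :=
    h.deriv_of_isOpen isOpen_Ioo (by norm_num)
  exact ⟨fun x hx => ((h.differentiableOn (by norm_num)).differentiableAt
      (isOpen_Ioo.mem_nhds hx)).hasDerivAt,
    fun x hx => ((h'.differentiableOn (by norm_num)).differentiableAt
      (isOpen_Ioo.mem_nhds hx)).hasDerivAt⟩

/-- Monotonicity properties of `g = y2/y1` and `B = g'² + (n-1)g²/sin²θ` built from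
first eigenfunctions `y1, y2` of the `m = 0` and `m = 1` radial problems on a geodesic
ball of radius `0 < θ1 ≤ π/2` in `S^n`: with `q = sin θ · g'/g`, one has
`0 ≤ q ≤ cos θ` and `q' ≤ 0` on `(0,θ1)`; consequently `g` is increasing and `B` is
decreasing on `(0,θ1)`. -/
theorem q_bounds_and_monotonicity (n : ℕ) (hn : 2 ≤ n)
    (θ1 : ℝ) (hθ1 : 0 < θ1) (hθ1' : θ1 ≤ π / 2)
    (lam1 lam2 : ℝ) (hlam1 : 0 < lam1) (hlam2 : 0 < lam2)
    (y1 y2 : ℝ → ℝ)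
    (hy1 : ContDiffOn ℝ 2 y1 (Ioo 0 θ1))
    (hy1pos : ∀ θ ∈ Ioo 0 θ1, 0 < y1 θ)
    (hy1bdd : ∃ M, ∀ᶠ θ in nhdsWithin 0 (Ioi 0), |y1 θ| ≤ M)
    (hy1d0 : Tendsto (fun θ => Real.sin θ ^ (n - 1) * deriv y1 θ)
      (nhdsWithin 0 (Ioi 0)) (nhds 0))
    (hode1 : ∀ θ ∈ Ioo 0 θ1,
      -(deriv (deriv y1) θ) - ((n : ℝ) - 1) * Real.cot θ * deriv y1 θ = lam1 * y1 θ)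
    (hy1θ1 : Tendsto y1 (nhdsWithin θ1 (Iio θ1)) (nhds 0))
    (hy2 : ContDiffOn ℝ 2 y2 (Ioo 0 θ1))
    (hy2pos : ∀ θ ∈ Ioo 0 θ1, 0 < y2 θ)
    (hode2 : ∀ θ ∈ Ioo 0 θ1,
      -(deriv (deriv y2) θ) - ((n : ℝ) - 1) * Real.cot θ * deriv y2 θ
        + ((n : ℝ) - 1) * y2 θ / Real.sin θ ^ 2 = lam2 * y2 θ)
    (hy20 : Tendsto y2 (nhdsWithin 0 (Ioi 0)) (nhds 0))
    (hy2θ1 : Tendsto y2 (nhdsWithin θ1 (Iio θ1)) (nhds 0))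
    (g q B : ℝ → ℝ)
    (hg : ∀ θ, g θ = y2 θ / y1 θ)
    (hq : ∀ θ, q θ = Real.sin θ * deriv g θ / g θ)
    (hB : ∀ θ, B θ = (deriv g θ) ^ 2 + ((n : ℝ) - 1) * (g θ) ^ 2 / Real.sin θ ^ 2) :
    (∀ θ ∈ Ioo 0 θ1, 0 ≤ q θ ∧ q θ ≤ Real.cos θ ∧ deriv q θ ≤ 0) ∧
    MonotoneOn g (Ioo 0 θ1) ∧
    AntitoneOn B (Ioo 0 θ1) := by
  obtain ⟨k, rfl⟩ := Nat.exists_eq_add_of_le' hn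
  have hcast : ((k + 2 : ℕ) : ℝ) - 1 = k + 1 := by push_cast; ring
  simp only [hcast, Real.cot_eq_cos_div_sin] at hode1 hode2 hB
  simp only [show k + 2 - 1 = k + 1 from rfl] at hy1d0
  have hsin : ∀ x ∈ Ioo 0 θ1, 0 < sin x := fun x hx => sin_pos_of_mem_Ioo hθ1' hx
  obtain ⟨h1, h1d⟩ := hasDerivAt_of_contDiffOn_two hy1
  obtain ⟨h2, h2d⟩ := hasDerivAt_of_contDiffOn_two hy2
  have h1' : ∀ x ∈ Ioo 0 θ1, HasDerivAt (deriv y1)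
      (-((k + 1) * (cos x / sin x) * deriv y1 x) - lam1 * y1 x) x := fun x hx =>
    (h1d x hx).congr_deriv (by linarith [hode1 x hx])
  have h2' : ∀ x ∈ Ioo 0 θ1, HasDerivAt (deriv y2) (-((k + 1) * (cos x / sin x) * deriv y2 x)
      - (lam2 - (k + 1) / sin x ^ 2) * y2 x) x := fun x hx =>
    (h2d x hx).congr_deriv (by
      have : (k + 1) / sin x ^ 2 * y2 x = (k + 1) * y2 x / sin x ^ 2 := by ring
      linarith [hode2 x hx])
  have hy1O : y1 =O[𝓝[>] 0] (fun _ => (1 : ℝ)) := by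
    obtain ⟨M, hM⟩ := hy1bdd
    exact IsBigO.of_bound M (by simpa using hM)
  have hφ1 := isBigO_one_sin_pow_mul_deriv (V := fun _ => lam1) hθ1 hθ1' h1' hy1θ1
    continuousAt_const
  have hφ2 := isBigO_one_sin_pow_mul_deriv (V := fun x => lam2 - (k + 1) / sin x ^ 2)
    hθ1 hθ1' h2' hy2θ1 (by
      have : sin θ1 ^ 2 ≠ 0 := (pow_pos (sin_pos_of_pos_of_lt_pi hθ1 (by linarith [pi_pos])) 2).ne'
      fun_prop (disch := assumption))
  have hφ20 := tendsto_sin_pow_mul_deriv_zero hθ1 hθ1' h2 hy2pos h2' hy20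
  have hl0 : Tendsto (fun x => sin x ^ (k + 1) * deriv y2 x * y1 x
      - sin x ^ (k + 1) * deriv y1 x * y2 x) (𝓝[>] 0) (𝓝 0) := by
    simpa using (tendsto_zero_mul_of_isBigO_one hφ20 hy1O).sub (hy1d0.mul hy20)
  have hl1 : Tendsto (fun x => sin x ^ (k + 1) * deriv y2 x * y1 x
      - sin x ^ (k + 1) * deriv y1 x * y2 x) (𝓝[<] θ1) (𝓝 0) := by
    have h := (tendsto_zero_mul_of_isBigO_one hy1θ1 hφ2).sub
      (tendsto_zero_mul_of_isBigO_one hy2θ1 hφ1)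
    rw [sub_zero] at h
    exact h.congr fun x => by ring
  have hW := wronskian_nonneg hθ1 hθ1' h1 h2 h1' h2' hy1pos hy2pos hl0 hl1
  set p : ℝ → ℝ := fun x => -(deriv y1 x / y1 x) with hp_def
  have hp : ∀ x ∈ Ioo 0 θ1,
      HasDerivAt p (p x ^ 2 - (k + 1) * (cos x / sin x) * p x + lam1) x :=
    fun x hx => hasDerivAt_neg_logDeriv (h1 x hx) (hy1pos x hx) (h1' x hx)
  have hpy : ∀ x ∈ Ioo 0 θ1, p x * y1 x = -deriv y1 x := fun x hx => by
    simp only [hp_def]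
    rw [neg_mul, div_mul_cancel₀ _ (hy1pos x hx).ne']
  have hy1p : ∀ x ∈ Ioo 0 θ1, HasDerivAt y1 (-(p x * y1 x)) x := fun x hx =>
    (h1 x hx).congr_deriv (by rw [hpy x hx, neg_neg])
  have hp0 : ∀ x ∈ Ioo 0 θ1, 0 ≤ p x := fun x hx => neg_nonneg.2
    (div_nonpos_of_nonpos_of_nonneg (deriv_nonpos_of_radial hθ1' hlam1.le hy1pos h1' hy1d0 x hx)
      (hy1pos x hx).le)
  have hpt : ∀ x ∈ Ioo 0 θ1, sin x ≤ p x * cos x := fun x hx => by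
    have h := sin_mul_add_cos_mul_deriv_nonpos hθ1' hlam1.le h1 hy1pos h1' hy1O hy1d0 hy1θ1 x hx
    refine le_of_mul_le_mul_right ?_ (hy1pos x hx)
    linear_combination h - cos x * hpy x hx
  have hpb : (fun x => p x / sin x) =O[𝓝[>] 0] (fun _ => (1 : ℝ)) :=
    isBigO_one_neg_logDeriv_div_sin hθ1 hθ1' hlam1.le h1 hy1pos h1' hy1O hy1d0
  have hpcot : MonotoneOn (fun x => p x * (cos x / sin x)) (Ioo 0 θ1) := by
    refine monotoneOn_Ioo_of_hasDerivAt_nonneg_s17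
      (fun x hx => (hp x hx).mul (hasDerivAt_cot (hsin x hx).ne')) (fun x hx => ?_)
    have h := riccati_le_sin_mul_cos_mul hθ1' hp hy1p hy1pos hy1O hpb hpt hθ1 x hx
    have hs := hsin x hx
    have : (p x ^ 2 - (k + 1) * (cos x / sin x) * p x + lam1) * (cos x / sin x)
        + p x * (-1 / sin x ^ 2) = (sin x * cos x
          * (p x ^ 2 - (k + 1) * (cos x / sin x) * p x + lam1) - p x) / sin x ^ 2 := by
      field_simp
      ring
    rw [this]
    exact div_nonneg (sub_nonneg.2 h) (sq_nonneg _)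
  have hX := cos_mul_sub_wronskian_nonneg hθ1' h1 h2 h1' h2' hy1pos hy2pos hpcot hl0 hl1
    (tendsto_zero_mul_of_isBigO_one hy20 hy1O) (by simpa using hy2θ1.mul hy1θ1)
  have hgd : ∀ x ∈ Ioo 0 θ1, HasDerivAt g (g x * (deriv y2 x / y2 x - deriv y1 x / y1 x)) x := by
    intro x hx
    have hy1x := (hy1pos x hx).ne'
    have hy2x := (hy2pos x hx).ne'
    rw [funext hg]
    refine ((h2 x hx).div (h1 x hx) hy1x).congr_deriv ?_
    field_simp
  have hgpos : ∀ x ∈ Ioo 0 θ1, 0 < g x := fun x hx => by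
    rw [hg]
    exact div_pos (hy2pos x hx) (hy1pos x hx)
  have hqe : ∀ x ∈ Ioo 0 θ1, q x = sin x * (deriv y2 x / y2 x - deriv y1 x / y1 x) := by
    intro x hx
    have := (hgpos x hx).ne'
    rw [hq, (hgd x hx).deriv]
    field_simp
  have hq0 : ∀ x ∈ Ioo 0 θ1, 0 ≤ q x := by
    intro x hx
    have hs := hsin x hx
    have hy1x := hy1pos x hx
    have hy2x := hy2pos x hx
    have : q x = sin x * (sin x ^ (k + 1) * deriv y2 x * y1 x
        - sin x ^ (k + 1) * deriv y1 x * y2 x) / (sin x ^ (k + 1) * y1 x * y2 x) := by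
      rw [hqe x hx]
      field_simp
    rw [this]
    exact div_nonneg (mul_nonneg hs.le (hW x hx)) (by positivity)
  have hq1 : ∀ x ∈ Ioo 0 θ1, q x ≤ cos x := by
    intro x hx
    have hs := hsin x hx
    have hy1x := hy1pos x hx
    have hy2x := hy2pos x hx
    have : cos x - q x = (sin x ^ (k + 1) * (cos x * y1 x * y2 x)
        - sin x * (sin x ^ (k + 1) * deriv y2 x * y1 x - sin x ^ (k + 1) * deriv y1 x * y2 x))
          / (sin x ^ (k + 1) * y1 x * y2 x) := by
      rw [hqe x hx]
      field_simp
    rw [← sub_nonneg, this]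
    exact div_nonneg (hX x hx) (by positivity)
  have hqd : ∀ x ∈ Ioo 0 θ1, HasDerivAt q ((2 * p x * sin x * q x - k * q x * cos x
      - (q x ^ 2 - (k + 1)) - (lam2 - lam1) * sin x ^ 2) / sin x) x := fun x hx =>
    hasDerivAt_sin_mul_logDeriv_div (hsin x hx).ne' (hy1pos x hx).ne' (hy2pos x hx).ne'
      (h1 x hx) (h2 x hx) (h1' x hx) (h2' x hx)
      (by filter_upwards [isOpen_Ioo.mem_nhds hx] with t ht using hqe t ht)
  have hqd0 := riccati_rhs_nonpos hθ1' hp hy1p hy1pos hy1θ1 hp0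
    (monotoneOn_convexity_quotient hθ1' hp hy1p hy1pos hy1O hpb hpt hθ1) hqd hq0 hq1
  have hgq : ∀ x ∈ Ioo 0 θ1, HasDerivAt g (g x * q x / sin x) x := fun x hx =>
    (hgd x hx).congr_deriv (by
      have := (hsin x hx).ne'
      rw [hqe x hx]
      field_simp)
  refine ⟨fun x hx => ⟨hq0 x hx, hq1 x hx, (hqd x hx).deriv.trans_le (hqd0 x hx)⟩,
    monotoneOn_Ioo_of_hasDerivAt_nonneg_s17 hgq fun x hx =>
      div_nonneg (mul_nonneg (hgpos x hx).le (hq0 x hx)) (hsin x hx).le, ?_⟩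
  have hqanti := antitoneOn_Ioo_of_hasDerivAt_nonpos hqd hqd0
  have hganti : AntitoneOn (fun x => g x / sin x) (Ioo 0 θ1) := by
    refine antitoneOn_Ioo_of_hasDerivAt_nonpos
      (fun x hx => (hgq x hx).div (hasDerivAt_sin x) (hsin x hx).ne') (fun x hx => ?_)
    refine div_nonpos_of_nonpos_of_nonneg ?_ (sq_nonneg _)
    rw [div_mul_cancel₀ _ (hsin x hx).ne', ← mul_sub]
    exact mul_nonpos_of_nonneg_of_nonpos (hgpos x hx).le (sub_nonpos.2 (hq1 x hx))
  have hBe : ∀ x ∈ Ioo 0 θ1, B x = (g x / sin x) ^ 2 * (q x ^ 2 + (k + 1)) := fun x hx => by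
    rw [hB, (hgq x hx).deriv]
    ring
  intro x hx z hz hxz
  rw [hBe x hx, hBe z hz]
  have hz0 : 0 ≤ g z / sin z := div_nonneg (hgpos z hz).le (hsin z hz).le
  have hqz := hq0 z hz
  have ha : g z / sin z ≤ g x / sin x := hganti hx hz hxz
  have hb := hqanti hx hz hxz
  gcongr
end

section
/- Convexity exclusion lemma for first-order ODEs: let a < b be reals and let F : (a,b) × ℝ → ℝ be such that for each fixed c ∈ ℝ the map θ ↦ F(θ, c) is strictly convex on (a,b). Suppose q : (a,b) → ℝ is differentiable and satisfies q'(θ) = F(θ, q(θ)) for all θ ∈ (a,b). Then there do not exist points α1 < α2 < α3 in (a,b) with q(α1) = q(α2) = q(α3), q'(α1) < 0, q'(α2) > 0, and q'(α3) < 0. -/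
open Set

/-- Convexity exclusion lemma: if `q' = F(θ, q)` with `F` strictly convex in `θ` for
each fixed value of the second argument, then there are no three points
`α1 < α2 < α3` where `q` takes a common value with `q'(α1) < 0`, `q'(α2) > 0`, and
`q'(α3) < 0`. -/
theorem convexity_exclusion (a b : ℝ) (hab : a < b) (F : ℝ → ℝ → ℝ)
    (hF : ∀ c : ℝ, StrictConvexOn ℝ (Ioo a b) fun θ => F θ c)
    (q : ℝ → ℝ) (hq : ∀ θ ∈ Ioo a b, HasDerivAt q (F θ (q θ)) θ) :
    ¬ ∃ α1 α2 α3, α1 ∈ Ioo a b ∧ α2 ∈ Ioo a b ∧ α3 ∈ Ioo a b ∧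
      α1 < α2 ∧ α2 < α3 ∧ q α1 = q α2 ∧ q α2 = q α3 ∧
      deriv q α1 < 0 ∧ 0 < deriv q α2 ∧ deriv q α3 < 0 := by
  rintro ⟨α1, α2, α3, h1, h2, h3, h12, h23, hq12, hq23, hd1, hd2, hd3⟩
  rw [(hq _ h1).deriv, hq12] at hd1
  rw [(hq _ h2).deriv] at hd2
  rw [(hq _ h3).deriv, ← hq23] at hd3
  have hle := (hF (q α2)).convexOn.le_max_of_mem_Icc h1 h3 ⟨h12.le, h23.le⟩
  exact (hd2.trans_le hle).not_gt (max_lt hd1 hd3)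
end

section
/- For n = 2, the function θ1² λ2(θ1) is strictly increasing on (0,π): let 0 < a < b < π. For each radius r ∈ {a,b}, suppose λ2(r) > 0 admits a solution y2 of −y'' − cot θ · y' + (sin θ)^{-2} y = λ2(r) y on (0,r) that is twice continuously differentiable and strictly positive on (0,r) with y2(θ) → 0 as θ → 0⁺ and as θ → r⁻ (a first eigenfunction of the m = 1 radial problem on S², so λ2(r) is the second Dirichlet eigenvalue of the geodesic disk of radius r). Then a² λ2(a) < b² λ2(b). -/
open Real Set Filter

/-- `y` is a first eigenfunction of the `m = 1` radial problem on `(0,θ1)` for `S²`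
(so `lam` is the second Dirichlet eigenvalue of the geodesic disk of radius `θ1`): a
positive, twice continuously differentiable solution of
`-y'' - cot θ · y' + y/sin²θ = λ y` vanishing at `0` and at `θ1`. -/
def IsSecondRadialEigenfunctionS2 (θ1 lam : ℝ) (y : ℝ → ℝ) : Prop :=
  ContDiffOn ℝ 2 y (Ioo 0 θ1) ∧
  (∀ θ ∈ Ioo 0 θ1, 0 < y θ) ∧
  (∀ θ ∈ Ioo 0 θ1,
    -(deriv (deriv y) θ) - Real.cot θ * deriv y θ + y θ / Real.sin θ ^ 2 = lam * y θ) ∧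
  Tendsto y (nhdsWithin 0 (Ioi 0)) (nhds 0) ∧
  Tendsto y (nhdsWithin θ1 (Iio θ1)) (nhds 0)

open Topology

/-- `U` is a positive solution of `U'' = Q U` on `(0,1)`, with derivative `V`, vanishing at both
endpoints. -/
structure IsPositiveDirichletSolution (Q U V : ℝ → ℝ) : Prop where
  pos : ∀ t ∈ Ioo (0 : ℝ) 1, 0 < U t
  hasDerivAt : ∀ t ∈ Ioo (0 : ℝ) 1, HasDerivAt U (V t) t
  hasDerivAt_deriv : ∀ t ∈ Ioo (0 : ℝ) 1, HasDerivAt V (Q t * U t) t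
  tendsto_zero : Tendsto U (𝓝[>] 0) (𝓝 0)
  tendsto_one : Tendsto U (𝓝[<] 1) (𝓝 0)

namespace IsPositiveDirichletSolution

variable {Q U V : ℝ → ℝ}

/-- Where the potential is nonnegative near the left endpoint, the solution is convex there and
its derivative stays bounded. -/
theorem isBoundedUnder_deriv_zero (h : IsPositiveDirichletSolution Q U V)
    (hQ : ∀ᶠ t in 𝓝[>] (0 : ℝ), 0 ≤ Q t) :
    IsBoundedUnder (· ≤ ·) (𝓝[>] 0) (norm ∘ V) := by
  obtain ⟨δ, hδ, hQδ⟩ := mem_nhdsGT_iff_exists_Ioo_subset.1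
    (hQ.and (Ioo_mem_nhdsGT (zero_lt_one' ℝ)))
  have hδ0 : 0 < δ := hδ
  have hsub : ∀ t ∈ Ioo 0 δ, t ∈ Ioo (0 : ℝ) 1 := fun t ht => (hQδ ht).2
  have hmono : MonotoneOn V (Ioo 0 δ) := by
    refine monotoneOn_of_deriv_nonneg (convex_Ioo 0 δ)
      (fun t ht => (h.hasDerivAt_deriv t (hsub t ht)).continuousAt.continuousWithinAt) ?_ ?_
    · rw [interior_Ioo]
      exact fun t ht =>
        (h.hasDerivAt_deriv t (hsub t ht)).differentiableAt.differentiableWithinAt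
    · rw [interior_Ioo]
      intro t ht
      rw [(h.hasDerivAt_deriv t (hsub t ht)).deriv]
      exact mul_nonneg (hQδ ht).1 (h.pos t (hsub t ht)).le
  have hnonneg : ∀ s ∈ Ioo 0 δ, 0 ≤ V s := by
    intro s hs
    by_contra! hneg
    have hanti : AntitoneOn U (Ioc 0 s) := by
      have hs' : ∀ t ∈ Ioc 0 s, t ∈ Ioo 0 δ := fun t ht => ⟨ht.1, ht.2.trans_lt hs.2⟩
      refine antitoneOn_of_deriv_nonpos (convex_Ioc 0 s)
        (fun t ht => (h.hasDerivAt t (hsub t (hs' t ht))).continuousAt.continuousWithinAt) ?_ ?_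
      · intro t ht
        exact (h.hasDerivAt t (hsub t (hs' t (interior_subset ht)))).differentiableAt
          |>.differentiableWithinAt
      · intro t ht
        have ht' := interior_subset ht
        rw [(h.hasDerivAt t (hsub t (hs' t ht'))).deriv]
        exact (hmono (hs' t ht') hs ht'.2).trans hneg.le
    refine (h.pos s (hsub s hs)).not_ge (ge_of_tendsto h.tendsto_zero ?_)
    filter_upwards [Ioo_mem_nhdsGT hs.1] with t ht
    exact hanti ⟨ht.1, ht.2.le⟩ ⟨hs.1, le_rfl⟩ ht.2.le
  refine ⟨V (δ / 2), ?_⟩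
  rw [eventually_map]
  filter_upwards [Ioo_mem_nhdsGT (half_pos hδ0)] with t ht
  have ht' : t ∈ Ioo 0 δ := ⟨ht.1, ht.2.trans (half_lt_self hδ0)⟩
  simp only [Function.comp_apply, Real.norm_eq_abs, abs_of_nonneg (hnonneg t ht')]
  exact hmono ht' ⟨half_pos hδ0, half_lt_self hδ0⟩ ht.2.le

/-- If the potential is continuous at the right endpoint, the derivative is bounded there. -/
theorem isBoundedUnder_deriv_one (h : IsPositiveDirichletSolution Q U V)
    (hQ : ContinuousAt Q 1) :
    IsBoundedUnder (· ≤ ·) (𝓝[<] 1) (norm ∘ V) := by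
  have hlim : Tendsto (fun t => ‖Q t * U t‖) (𝓝[<] 1) (𝓝 0) := by
    simpa using ((hQ.tendsto.mono_left nhdsWithin_le_nhds).mul h.tendsto_one).norm
  obtain ⟨δ, hδ, hQδ⟩ := mem_nhdsLT_iff_exists_Ioo_subset.1
    ((hlim.eventually_le_const (zero_lt_one' ℝ)).and (Ioo_mem_nhdsLT (zero_lt_one' ℝ)))
  have hδ1 : δ < 1 := hδ
  have hm : (δ + 1) / 2 ∈ Ioo δ 1 := ⟨by linarith, by linarith⟩
  refine ⟨1 * ‖1 - δ‖ + ‖V ((δ + 1) / 2)‖, ?_⟩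
  rw [eventually_map]
  filter_upwards [Ioo_mem_nhdsLT hδ1] with t ht
  have hle := (convex_Ioo δ 1).norm_image_sub_le_of_norm_hasDerivWithin_le
    (fun s hs => (h.hasDerivAt_deriv s (hQδ hs).2).hasDerivWithinAt)
    (fun s hs => (hQδ hs).1) hm ht
  have hdist : ‖t - (δ + 1) / 2‖ ≤ ‖1 - δ‖ := by
    rw [Real.norm_eq_abs, Real.norm_eq_abs, abs_of_pos (by linarith : 0 < 1 - δ), abs_le]
    constructor <;> linarith [ht.1, ht.2]
  have := norm_le_norm_add_norm_sub' (V t) (V ((δ + 1) / 2))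
  simp only [Function.comp_apply]
  linarith

end IsPositiveDirichletSolution

/-- Sturm comparison: a strictly larger potential cannot also have a positive solution vanishing
at both endpoints. -/
theorem not_forall_lt_of_isPositiveDirichletSolution {Q₁ Q₂ U₁ U₂ V₁ V₂ : ℝ → ℝ}
    (h₁ : IsPositiveDirichletSolution Q₁ U₁ V₁) (h₂ : IsPositiveDirichletSolution Q₂ U₂ V₂)
    (hQ₁ : ∀ᶠ t in 𝓝[>] (0 : ℝ), 0 ≤ Q₁ t) (hQ₂ : ∀ᶠ t in 𝓝[>] (0 : ℝ), 0 ≤ Q₂ t)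
    (hc₁ : ContinuousAt Q₁ 1) (hc₂ : ContinuousAt Q₂ 1) :
    ¬ ∀ t ∈ Ioo (0 : ℝ) 1, Q₁ t < Q₂ t := by
  intro hlt
  let P : ℝ → ℝ := fun t => V₁ t * U₂ t - U₁ t * V₂ t
  have hP : ∀ t ∈ Ioo (0 : ℝ) 1, HasDerivAt P ((Q₁ t - Q₂ t) * (U₁ t * U₂ t)) t := by
    intro t ht
    refine (((h₁.hasDerivAt_deriv t ht).mul (h₂.hasDerivAt t ht)).sub
      ((h₁.hasDerivAt t ht).mul (h₂.hasDerivAt_deriv t ht))).congr_deriv ?_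
    ring
  have hanti : StrictAntiOn P (Ioo 0 1) := by
    refine strictAntiOn_of_deriv_neg (convex_Ioo 0 1)
      (fun t ht => (hP t ht).continuousAt.continuousWithinAt) ?_
    rw [interior_Ioo]
    intro t ht
    rw [(hP t ht).deriv]
    exact mul_neg_of_neg_of_pos (sub_neg.2 (hlt t ht)) (mul_pos (h₁.pos t ht) (h₂.pos t ht))
  have hP0 : Tendsto P (𝓝[>] 0) (𝓝 0) := by
    simpa using (isBoundedUnder_le_mul_tendsto_zero (h₁.isBoundedUnder_deriv_zero hQ₁)
      h₂.tendsto_zero).sub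
      (h₁.tendsto_zero.zero_mul_isBoundedUnder_le (h₂.isBoundedUnder_deriv_zero hQ₂))
  have hP1 : Tendsto P (𝓝[<] 1) (𝓝 0) := by
    simpa using (isBoundedUnder_le_mul_tendsto_zero (h₁.isBoundedUnder_deriv_one hc₁)
      h₂.tendsto_one).sub
      (h₁.tendsto_one.zero_mul_isBoundedUnder_le (h₂.isBoundedUnder_deriv_one hc₂))
  have hm₁ : (1 / 3 : ℝ) ∈ Ioo (0 : ℝ) 1 := by constructor <;> norm_num
  have hm₂ : (2 / 3 : ℝ) ∈ Ioo (0 : ℝ) 1 := by constructor <;> norm_num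
  have h0 : P (1 / 3) ≤ 0 := by
    refine ge_of_tendsto hP0 ?_
    filter_upwards [Ioo_mem_nhdsGT hm₁.1] with t ht
    exact (hanti ⟨ht.1, ht.2.trans hm₁.2⟩ hm₁ ht.2).le
  have h1 : 0 ≤ P (2 / 3) := by
    refine le_of_tendsto hP1 ?_
    filter_upwards [Ioo_mem_nhdsLT hm₂.2] with t ht
    exact (hanti hm₂ ⟨hm₂.1.trans ht.1, ht.2⟩ ht.1).le
  have := hanti hm₁ hm₂ (by norm_num)
  linarith

/-- The potential of the `m = 1` radial problem on the disk of radius `r`, in Liouville normal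
form and rescaled to `(0,1)`. -/
noncomputable def liouvillePotential (r lam t : ℝ) : ℝ :=
  r ^ 2 * (3 / (4 * Real.sin (r * t) ^ 2) - 1 / 4 - lam)

theorem eventually_liouvillePotential_nonneg {r : ℝ} (hr : 0 < r) (hrπ : r < π) (lam : ℝ) :
    ∀ᶠ t in 𝓝[>] (0 : ℝ), 0 ≤ liouvillePotential r lam t := by
  have hlim : Tendsto (fun t => 4 * Real.sin (r * t) ^ 2 * (1 / 4 + lam)) (𝓝[>] 0) (𝓝 0) := by
    have : Continuous fun t => 4 * Real.sin (r * t) ^ 2 * (1 / 4 + lam) := by fun_prop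
    simpa using (this.tendsto 0).mono_left nhdsWithin_le_nhds
  filter_upwards [hlim.eventually_le_const (by norm_num : (0 : ℝ) < 3),
    Ioo_mem_nhdsGT (zero_lt_one' ℝ)] with t ht ht1
  have hsin : 0 < Real.sin (r * t) :=
    Real.sin_pos_of_pos_of_lt_pi (mul_pos hr ht1.1) (by nlinarith [ht1.2])
  have : 1 / 4 + lam ≤ 3 / (4 * Real.sin (r * t) ^ 2) := by
    rw [le_div_iff₀ (by positivity)]
    linarith
  exact mul_nonneg (sq_nonneg r) (by linarith)

theorem continuousAt_liouvillePotential_one {r : ℝ} (hr : 0 < r) (hrπ : r < π) (lam : ℝ) :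
    ContinuousAt (liouvillePotential r lam) 1 := by
  have hsin : Real.sin (r * 1) ≠ 0 := by
    rw [mul_one]
    exact (Real.sin_pos_of_pos_of_lt_pi hr hrπ).ne'
  have : (4 * Real.sin (r * 1) ^ 2) ≠ 0 := by positivity
  unfold liouvillePotential
  fun_prop (disch := assumption)

/-- The function `√(sin θ) y(θ)`, rescaled to `(0,1)`, solves the problem in Liouville normal
form. -/
theorem IsSecondRadialEigenfunctionS2.exists_isPositiveDirichletSolution {r lam : ℝ}
    {y : ℝ → ℝ} (hr : 0 < r) (hrπ : r < π) (h : IsSecondRadialEigenfunctionS2 r lam y) :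
    ∃ U V, IsPositiveDirichletSolution (liouvillePotential r lam) U V := by
  obtain ⟨hC, hpos, heq, h0, h1⟩ := h
  have hmem : ∀ t ∈ Ioo (0 : ℝ) 1, r * t ∈ Ioo 0 r := fun t ht =>
    ⟨mul_pos hr ht.1, by nlinarith [ht.2]⟩
  have hsin : ∀ x ∈ Ioo 0 r, 0 < Real.sin x := fun x hx =>
    Real.sin_pos_of_pos_of_lt_pi hx.1 (hx.2.trans hrπ)
  have hdy : ∀ x ∈ Ioo 0 r, HasDerivAt y (deriv y x) x := fun x hx =>
    ((hC.differentiableOn (by norm_num)).differentiableAt (Ioo_mem_nhds hx.1 hx.2)).hasDerivAt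
  have hddy : ∀ x ∈ Ioo 0 r, HasDerivAt (deriv y) (deriv (deriv y) x) x := fun x hx =>
    (((hC.deriv_of_isOpen isOpen_Ioo (by norm_num : (1 : WithTop ℕ∞) + 1 ≤ 2)).differentiableOn
      (by norm_num)).differentiableAt (Ioo_mem_nhds hx.1 hx.2)).hasDerivAt
  have hscale : ∀ t : ℝ, HasDerivAt (fun s => r * s) r t := fun t => by
    simpa using (hasDerivAt_id t).const_mul r
  have hsqrt : ∀ x ∈ Ioo 0 r,
      HasDerivAt (fun x => √(Real.sin x)) (Real.cos x / (2 * √(Real.sin x))) x := fun x hx =>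
    (Real.hasDerivAt_sin x).sqrt (hsin x hx).ne'
  have hlim : ∀ {l : Filter ℝ}, Tendsto (fun t => y (r * t)) l (𝓝 0) →
      Tendsto (fun t => √(Real.sin (r * t)) * y (r * t)) l (𝓝 0) := by
    intro l hl
    refine isBoundedUnder_le_mul_tendsto_zero (isBoundedUnder_of ⟨1, fun t => ?_⟩) hl
    simp only [Function.comp_apply, Real.norm_eq_abs, abs_of_nonneg (Real.sqrt_nonneg _)]
    exact Real.sqrt_le_one.2 (Real.sin_le_one _)
  refine ⟨fun t => √(Real.sin (r * t)) * y (r * t), fun t =>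
    (Real.cos (r * t) / (2 * √(Real.sin (r * t))) * y (r * t) +
      √(Real.sin (r * t)) * deriv y (r * t)) * r, ?_, ?_, ?_, hlim ?_, hlim ?_⟩
  · exact fun t ht => mul_pos (Real.sqrt_pos.2 (hsin _ (hmem t ht))) (hpos _ (hmem t ht))
  · exact fun t ht => HasDerivAt.comp t
      ((hsqrt _ (hmem t ht)).mul (hdy _ (hmem t ht))) (hscale t)
  · intro t ht
    have hx := hmem t ht
    have hs := Real.sqrt_pos.2 (hsin _ hx)
    have hd := (HasDerivAt.comp t ((((Real.hasDerivAt_cos (r * t)).div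
      ((hsqrt _ hx).const_mul 2) (by positivity)).mul (hdy _ hx)).add
      ((hsqrt _ hx).mul (hddy _ hx))) (hscale t)).mul_const r
    refine hd.congr_deriv ?_
    have hode : deriv (deriv y) (r * t) = -(Real.cot (r * t) * deriv y (r * t)) +
        y (r * t) / Real.sin (r * t) ^ 2 - lam * y (r * t) := by
      linarith [heq _ hx]
    have hsq := Real.sq_sqrt (hsin _ hx).le
    have hcs := Real.sin_sq_add_cos_sq (r * t)
    simp only [Pi.div_apply]
    rw [hode, Real.cot_eq_cos_div_sin, liouvillePotential]
    generalize √(Real.sin (r * t)) = s at *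
    rw [← hsq] at hcs ⊢
    have hc2 : Real.cos (r * t) ^ 2 = 1 - s ^ 4 := by linear_combination hcs
    field_simp
    ring_nf
    simp only [hc2]
    ring
  · refine h0.comp (tendsto_nhdsWithin_iff.2 ⟨?_, ?_⟩)
    · simpa using ((hscale 0).continuousAt.tendsto).mono_left nhdsWithin_le_nhds
    · filter_upwards [self_mem_nhdsWithin] with t ht using mul_pos hr ht
  · refine h1.comp (tendsto_nhdsWithin_iff.2 ⟨?_, ?_⟩)
    · simpa using ((hscale 1).continuousAt.tendsto).mono_left nhdsWithin_le_nhds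
    · filter_upwards [self_mem_nhdsWithin] with t ht
      have : t < 1 := ht
      exact mem_Iio.2 (by nlinarith)

theorem three_mul_sin_sub_mul_cos_sub_sin_pow_pos {x : ℝ} (hx : 0 < x) (hxπ : x < π) :
    0 < 3 * Real.sin x - 3 * x * Real.cos x - Real.sin x ^ 3 := by
  have hd : ∀ x : ℝ, HasDerivAt
      (fun x => 3 * Real.sin x - 3 * x * Real.cos x - Real.sin x ^ 3)
      (3 * Real.sin x * (x - Real.sin x * Real.cos x)) x := by
    intro x
    refine ((((Real.hasDerivAt_sin x).const_mul 3).sub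
      (((hasDerivAt_id x).const_mul 3).mul (Real.hasDerivAt_cos x))).sub
      ((Real.hasDerivAt_sin x).pow 3)).congr_deriv ?_
    simp
    ring
  have hmono : StrictMonoOn (fun x => 3 * Real.sin x - 3 * x * Real.cos x - Real.sin x ^ 3)
      (Icc 0 π) := by
    refine strictMonoOn_of_deriv_pos (convex_Icc 0 π) (by fun_prop) ?_
    rw [interior_Icc]
    intro x hx
    rw [(hd x).deriv]
    have hs := Real.sin_pos_of_pos_of_lt_pi hx.1 hx.2
    have hlt := Real.sin_lt hx.1
    have := mul_le_of_le_one_right hs.le (Real.cos_le_one x)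
    exact mul_pos (by positivity) (by linarith)
  simpa using hmono ⟨le_rfl, Real.pi_pos.le⟩ ⟨hx.le, hxπ.le⟩ hx

theorem strictMonoOn_sq_mul_three_div_sin_sq_sub_one :
    StrictMonoOn (fun x => x ^ 2 * (3 / (4 * Real.sin x ^ 2) - 1 / 4)) (Ioo 0 π) := by
  have hd : ∀ x ∈ Ioo 0 π, HasDerivAt
      (fun x => x ^ 2 * (3 / (4 * Real.sin x ^ 2) - 1 / 4))
      (x / (2 * Real.sin x ^ 3) *
        (3 * Real.sin x - 3 * x * Real.cos x - Real.sin x ^ 3)) x := by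
    intro x hx
    have hs := Real.sin_pos_of_pos_of_lt_pi hx.1 hx.2
    refine ((hasDerivAt_pow 2 x).mul (((hasDerivAt_const x (3 : ℝ)).div
      (((Real.hasDerivAt_sin x).pow 2).const_mul 4)
      (mul_pos four_pos (pow_pos hs 2)).ne').sub_const
      (1 / 4))).congr_deriv ?_
    simp
    field_simp
    ring
  refine strictMonoOn_of_deriv_pos (convex_Ioo 0 π)
    (fun x hx => (hd x hx).continuousAt.continuousWithinAt) ?_
  rw [interior_Ioo]
  intro x hx
  rw [(hd x hx).deriv]
  have hs := Real.sin_pos_of_pos_of_lt_pi hx.1 hx.2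
  have hx0 := hx.1
  exact mul_pos (by positivity) (three_mul_sin_sub_mul_cos_sub_sin_pow_pos hx.1 hx.2)

/-- For `n = 2`, the function `θ1² λ₂(θ1)` is strictly increasing on `(0,π)` for
geodesic disks in `S²`. -/
theorem sq_radius_mul_second_eigenvalue_strictMono_S2
    (a b : ℝ) (ha : 0 < a) (hab : a < b) (hb : b < π)
    (lam2a lam2b : ℝ) (hlam2a : 0 < lam2a) (hlam2b : 0 < lam2b)
    (y2a y2b : ℝ → ℝ)
    (h2a : IsSecondRadialEigenfunctionS2 a lam2a y2a)
    (h2b : IsSecondRadialEigenfunctionS2 b lam2b y2b) :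
    a ^ 2 * lam2a < b ^ 2 * lam2b := by
  by_contra! hle
  have hb0 := ha.trans hab
  have haπ := hab.trans hb
  obtain ⟨U₁, V₁, h₁⟩ := h2a.exists_isPositiveDirichletSolution ha haπ
  obtain ⟨U₂, V₂, h₂⟩ := h2b.exists_isPositiveDirichletSolution hb0 hb
  refine not_forall_lt_of_isPositiveDirichletSolution h₁ h₂
    (eventually_liouvillePotential_nonneg ha haπ _)
    (eventually_liouvillePotential_nonneg hb0 hb _)
    (continuousAt_liouvillePotential_one ha haπ _)
    (continuousAt_liouvillePotential_one hb0 hb _) fun t ht => ?_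
  have hmem : ∀ {r : ℝ}, 0 < r → r < π → r * t ∈ Ioo 0 π := fun hr hrπ =>
    ⟨mul_pos hr ht.1, by nlinarith [ht.2]⟩
  have hlt := strictMonoOn_sq_mul_three_div_sin_sq_sub_one (hmem ha haπ) (hmem hb0 hb)
    (mul_lt_mul_of_pos_right hab ht.1)
  simp only [mul_pow, mul_right_comm _ (t ^ 2)] at hlt
  have := lt_of_mul_lt_mul_right hlt (sq_nonneg t)
  unfold liouvillePotential
  linarith
end
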